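/- arXiv:2101.00833 — 3 statements merged into one kernel-verified Lean document; each statement's English description precedes it below -/
import Mathlib

section
/- Let N ≥ 1, let E be a real N×N matrix, and let F : [0,∞) → ℝ^{N×N} be continuous with ∫₀^∞ ‖F(t)‖ dt < ∞ and ∫₀^∞ t‖F(t)‖ dt < ∞. Set F₊ = ∫₀^∞ ‖F(t)‖ dt and p_F(t) = ‖F(t)‖/F₊ (assume F₊ > 0). Suppose the matrix E + ∫₀^∞ F(t) dt is Hurwitz, and let λ₁ denote its eigenvalue with the largest real part. If ∫₀^∞ t·p_F(t) dt < 2|Re(λ₁)|^N / (N·(2‖E‖ + 2F₊)^N · F₊), then every continuously differentiable function y : [0,∞) → ℝ^N satisfying y'(t) = E·y(t) + ∫₀^t F(t−τ)·y(τ) dτ for all t ≥ 0 converges to 0 as t → ∞. -/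
open MeasureTheory Set Filter

/-- Operator norm of a real matrix induced by the Euclidean norm. -/
noncomputable def opNormR {N : ℕ} (M : Matrix (Fin N) (Fin N) ℝ) : ℝ :=
  ‖LinearMap.toContinuousLinearMap (Matrix.toEuclideanLin M)‖

/-- A real square matrix is Hurwitz if every eigenvalue of its complexification has
negative real part. -/
def IsHurwitz {N : ℕ} (M : Matrix (Fin N) (Fin N) ℝ) : Prop :=
  ∀ μ ∈ spectrum ℂ (M.map Complex.ofReal), μ.re < 0

open scoped InnerProductSpace

section
variable {V : Type*} [NormedAddCommGroup V] [InnerProductSpace ℂ V] [FiniteDimensional ℂ V]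

theorem norm_det_mul_norm_le (T : V →L[ℂ] V) (v : V) :
    ‖LinearMap.det (T : V →ₗ[ℂ] V)‖ * ‖v‖ ≤ ‖T v‖ * ‖T‖ ^ (Module.finrank ℂ V - 1) := by
  have : CompleteSpace V := FiniteDimensional.complete ℂ V
  set S : V →ₗ[ℂ] V := (T : V →ₗ[ℂ] V).adjoint ∘ₗ (T : V →ₗ[ℂ] V) with hSdef
  have hS : S.IsSymmetric := (T : V →ₗ[ℂ] V).isSymmetric_adjoint_mul_self
  set σ := hS.eigenvalues rfl with hσ
  set b := hS.eigenvectorBasis rfl with hb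
  have hSb (i) : S (b i) = (σ i : ℂ) • b i := hS.apply_eigenvectorBasis rfl i
  have hSinner (x y : V) : ⟪x, S y⟫_ℂ = ⟪T x, T y⟫_ℂ := by
    simp [hSdef, LinearMap.adjoint_inner_right]
  have hσT (i) : σ i = ‖T (b i)‖ ^ 2 := by
    have h := hSinner (b i) (b i)
    rw [hSb, inner_smul_right, inner_self_eq_norm_sq_to_K, inner_self_eq_norm_sq_to_K,
      b.norm_eq_one] at h
    simp only [Complex.coe_algebraMap, Complex.ofReal_one, one_pow, mul_one] at h
    exact_mod_cast h
  have hσ0 (i) : 0 ≤ σ i := by rw [hσT]; positivity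
  have hσle (i) : σ i ≤ ‖T‖ ^ 2 := by
    rw [hσT]
    gcongr
    simpa using T.le_opNorm (b i)
  have hdet : ‖LinearMap.det (T : V →ₗ[ℂ] V)‖ ^ 2 = ∏ i, σ i := by
    have h1 := LinearMap.normDet_sq (T : V →ₗ[ℂ] V)
    have h2 := hS.det_eq_prod_eigenvalues rfl
    rw [LinearMap.normDet_eq_norm_det] at h1
    rw [← hSdef, h2] at h1
    exact_mod_cast h1
  have hTv : ‖T v‖ ^ 2 = ∑ i, σ i * ‖⟪b i, v⟫_ℂ‖ ^ 2 := by
    have h := hSinner v v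
    rw [← b.sum_inner_mul_inner v (S v), inner_self_eq_norm_sq_to_K] at h
    have h' (i) : ⟪v, b i⟫_ℂ * ⟪b i, S v⟫_ℂ = ((σ i * ‖⟪b i, v⟫_ℂ‖ ^ 2 : ℝ) : ℂ) := by
      rw [← hS (b i) v, hSb, inner_smul_left, ← inner_conj_symm v (b i)]
      push_cast
      rw [Complex.conj_ofReal, ← Complex.conj_mul']
      ring
    simp only [h', Complex.coe_algebraMap] at h
    exact_mod_cast h.symm
  have hv : ‖v‖ ^ 2 = ∑ i, ‖⟪b i, v⟫_ℂ‖ ^ 2 := (b.sum_sq_norm_inner_right v).symm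
  refine (pow_le_pow_iff_left₀ (by positivity) (by positivity) two_ne_zero).mp ?_
  rw [mul_pow, mul_pow, hdet, hTv, hv, Finset.mul_sum, Finset.sum_mul]
  refine Finset.sum_le_sum fun i _ => ?_
  rw [← Finset.mul_prod_erase _ _ (Finset.mem_univ i)]
  have : ∏ j ∈ Finset.univ.erase i, σ j ≤ (‖T‖ ^ (Module.finrank ℂ V - 1)) ^ 2 := by
    calc _ ≤ ∏ j ∈ Finset.univ.erase i, ‖T‖ ^ 2 :=
          Finset.prod_le_prod (fun j _ => hσ0 j) (fun j _ => hσle j)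
      _ = _ := by
        rw [Finset.prod_const, Finset.card_erase_of_mem (Finset.mem_univ i), Finset.card_univ,
          Fintype.card_fin, pow_right_comm]
  have := mul_le_mul_of_nonneg_left this (mul_nonneg (hσ0 i) (sq_nonneg ‖⟪b i, v⟫_ℂ‖))
  linarith

theorem pow_le_norm_det_algebraMap_sub (A : V →ₗ[ℂ] V) {r : ℝ} (hr : 0 ≤ r)
    (hA : ∀ μ ∈ spectrum ℂ A, μ.re ≤ -r) {s : ℂ} (hs : 0 ≤ s.re) :
    r ^ Module.finrank ℂ V ≤ ‖LinearMap.det (algebraMap ℂ (Module.End ℂ V) s - A)‖ := by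
  have hsplit : A.charpoly.Splits := IsAlgClosed.splits _
  rw [← LinearMap.eval_charpoly, hsplit.eval_eq_prod_roots_of_monic A.charpoly_monic,
    ← A.charpoly_natDegree, hsplit.natDegree_eq_card_roots]
  have key (m : Multiset ℂ) (hm : ∀ z ∈ m, r ≤ ‖s - z‖) :
      r ^ Multiset.card m ≤ ‖(m.map fun z => s - z).prod‖ := by
    induction m using Multiset.induction_on with
    | empty => simp
    | cons a m ih =>
      rw [Multiset.card_cons, Multiset.map_cons, Multiset.prod_cons, norm_mul, pow_succ']
      gcongr
      · exact hm a (Multiset.mem_cons_self a m)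
      · exact ih fun z hz => hm z (Multiset.mem_cons_of_mem hz)
  refine key _ fun z hz => ?_
  have hz' := hA z ((Module.End.mem_spectrum_iff_isRoot_charpoly A z).mpr
    (Polynomial.isRoot_of_mem_roots hz))
  have := Complex.re_le_norm (s - z)
  rw [Complex.sub_re] at this
  linarith

theorem exists_pos_mul_norm_le_norm_smul_sub (A : V →L[ℂ] V) {r M T : ℝ} (hr : 0 ≤ r)
    (hM : 0 < M) (hT : 0 ≤ T) (hA : ∀ μ ∈ spectrum ℂ (A : V →ₗ[ℂ] V), μ.re ≤ -r) (hAM : ‖A‖ ≤ M)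
    (hMT : M * (2 * M) ^ (Module.finrank ℂ V - 1) * T < r ^ Module.finrank ℂ V) :
    ∃ δ > 0, ∀ (s : ℂ) (B : V →L[ℂ] V), 0 ≤ s.re → ‖B‖ ≤ M → ‖B - A‖ ≤ ‖s‖ * T →
      ∀ v, δ * (1 + ‖s‖) * ‖v‖ ≤ ‖s • v - B v‖ := by
  set n := Module.finrank ℂ V
  obtain ⟨ε, hε, hεlt⟩ : ∃ ε > 0, (M + ε) * (2 * M + ε) ^ (n - 1) * T < r ^ n := by
    have hc : ContinuousAt (fun ε : ℝ => (M + ε) * (2 * M + ε) ^ (n - 1) * T) 0 := by fun_prop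
    have hev := hc.eventually_lt_const (u := r ^ n) (by simpa using hMT)
    exact ((hev.filter_mono (nhdsWithin_le_nhds (s := Ioi 0))).and self_mem_nhdsWithin).exists.imp
      fun ε h => ⟨h.2, h.1⟩
  set P := (2 * M + ε) ^ (n - 1)
  have hP : 0 < P := by positivity
  set κ := r ^ n - (M + ε) * P * T with hκ
  have hκ0 : 0 < κ := sub_pos.mpr hεlt
  refine ⟨min (κ / (P * (1 + M + ε))) (ε / (1 + M + ε)), by positivity, ?_⟩
  intro s B hs hB hBA v
  have hD : 0 < 1 + M + ε := by positivity
  rcases le_total ‖s‖ (M + ε) with hsM | hsM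
  · set X : V →L[ℂ] V := s • ContinuousLinearMap.id ℂ V - A with hX
    have hdet : r ^ n ≤ ‖LinearMap.det (X : V →ₗ[ℂ] V)‖ := by
      refine (pow_le_norm_det_algebraMap_sub (A : V →ₗ[ℂ] V) hr hA hs).trans_eq ?_
      congr 2
    have hXn : ‖X‖ ≤ 2 * M + ε := by
      refine (norm_sub_le _ _).trans ?_
      have : ‖s • ContinuousLinearMap.id ℂ V‖ ≤ ‖s‖ := by
        rw [norm_smul]
        exact mul_le_of_le_one_right (norm_nonneg _) ContinuousLinearMap.norm_id_le
      linarith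
    have h1 : r ^ n * ‖v‖ ≤ ‖X v‖ * P := by
      refine (mul_le_mul_of_nonneg_right hdet (norm_nonneg v)).trans
        ((norm_det_mul_norm_le X v).trans ?_)
      exact mul_le_mul_of_nonneg_left (pow_le_pow_left₀ (norm_nonneg _) hXn _) (norm_nonneg _)
    have h2 : ‖X v‖ ≤ ‖s • v - B v‖ + (M + ε) * T * ‖v‖ := by
      have : X v = (s • v - B v) + (B - A) v := by simp [hX]
      rw [this]
      refine (norm_add_le _ _).trans ?_
      gcongr
      refine ((B - A).le_opNorm v).trans ?_
      gcongr
      exact hBA.trans (by gcongr)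
    have h3 : κ * ‖v‖ ≤ ‖s • v - B v‖ * P := by
      have := mul_le_mul_of_nonneg_right h2 hP.le
      rw [hκ]
      linarith
    calc _ ≤ κ / (P * (1 + M + ε)) * (1 + (M + ε)) * ‖v‖ := by
          gcongr
          exact min_le_left _ _
      _ = κ * ‖v‖ / P := by field_simp; ring
      _ ≤ _ := by rwa [div_le_iff₀ hP]
  · have h1 : (‖s‖ - M) * ‖v‖ ≤ ‖s • v - B v‖ := by
      have h := norm_sub_norm_le (s • v) (B v)
      have h' := (B.le_opNorm v).trans (mul_le_mul_of_nonneg_right hB (norm_nonneg v))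
      rw [norm_smul] at h
      linarith
    refine le_trans ?_ h1
    gcongr
    calc _ ≤ ε / (1 + M + ε) * (1 + ‖s‖) := by
          gcongr
          exact min_le_right _ _
      _ ≤ _ := by
        rw [div_mul_eq_mul_div, div_le_iff₀ hD]
        nlinarith
end

section LaplaceTransform
variable {X : Type*} [NormedAddCommGroup X] [NormedSpace ℂ X]

/-- The one-sided Laplace transform of a vector-valued function. -/
noncomputable def laplaceTransform (g : ℝ → X) (s : ℂ) : X :=
  ∫ t in Ioi (0 : ℝ), Complex.exp (-(s * t)) • g t

theorem integrableOn_exp_smul_of_re_le {g : ℝ → X} {c s : ℂ}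
    (hg : IntegrableOn (fun t : ℝ => Complex.exp (-(c * t)) • g t) (Ioi 0)) (hcs : c.re ≤ s.re) :
    IntegrableOn (fun t : ℝ => Complex.exp (-(s * t)) • g t) (Ioi 0) := by
  have h : IntegrableOn (fun t : ℝ => Complex.exp (-((s - c) * t)) •
      Complex.exp (-(c * t)) • g t) (Ioi 0) := by
    refine Integrable.bdd_smul hg 1 ?_ ?_
    · exact Continuous.aestronglyMeasurable (by fun_prop)
    · filter_upwards [ae_restrict_mem measurableSet_Ioi] with t ht
      have ht' : 0 < t := ht
      rw [Complex.norm_exp]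
      simp only [Complex.neg_re, Complex.mul_re, Complex.sub_re, Complex.ofReal_re,
        Complex.ofReal_im, mul_zero, sub_zero, Real.exp_le_one_iff]
      nlinarith
  refine h.congr_fun (fun t _ => ?_) measurableSet_Ioi
  simp only [smul_smul, ← Complex.exp_add]
  ring_nf

theorem integrableOn_exp_smul_of_norm_le {g : ℝ → X} {a C : ℝ} {s : ℂ}
    (hg : ContinuousOn g (Ioi 0)) (hC : ∀ t ∈ Ioi (0 : ℝ), ‖g t‖ ≤ C * Real.exp (a * t))
    (hs : a < s.re) : IntegrableOn (fun t : ℝ => Complex.exp (-(s * t)) • g t) (Ioi 0) := by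
  refine Integrable.mono' ((exp_neg_integrableOn_Ioi 0 (sub_pos.mpr hs)).const_mul C) ?_ ?_
  · exact ContinuousOn.aestronglyMeasurable (by fun_prop) measurableSet_Ioi
  · filter_upwards [ae_restrict_mem measurableSet_Ioi] with t ht
    rw [norm_smul, Complex.norm_exp]
    refine (mul_le_mul_of_nonneg_left (hC t ht) (Real.exp_pos _).le).trans_eq ?_
    rw [mul_left_comm, ← Real.exp_add]
    congr 2
    simp
    ring

theorem hasDerivAt_laplaceTransform {g : ℝ → X} {c s : ℂ}
    (hg : IntegrableOn (fun t : ℝ => Complex.exp (-(c * t)) • g t) (Ioi 0))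
    (hg' : IntegrableOn (fun t : ℝ => Complex.exp (-(c * t)) • (t : ℂ) • g t) (Ioi 0))
    (hcs : c.re < s.re) :
    HasDerivAt (laplaceTransform g) (-laplaceTransform (fun t => (t : ℂ) • g t) s) s := by
  have key := (hasDerivAt_integral_of_dominated_loc_of_deriv_le
    (μ := volume.restrict (Ioi (0 : ℝ))) (x₀ := s) (s := {z : ℂ | c.re < z.re})
    (F := fun (z : ℂ) (t : ℝ) => Complex.exp (-(z * t)) • g t)
    (F' := fun (z : ℂ) (t : ℝ) => -(Complex.exp (-(z * t)) • (t : ℂ) • g t))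
    (bound := fun t => ‖Complex.exp (-(c * t)) • (t : ℂ) • g t‖)
    ((isOpen_lt continuous_const Complex.continuous_re).mem_nhds hcs) ?_
    (integrableOn_exp_smul_of_re_le hg hcs.le) ?_ ?_ hg'.norm ?_).2
  · rw [integral_neg] at key
    exact key
  · filter_upwards [(isOpen_lt continuous_const Complex.continuous_re).mem_nhds hcs] with z hz
    exact (integrableOn_exp_smul_of_re_le hg hz.le).aestronglyMeasurable
  · exact (integrableOn_exp_smul_of_re_le hg' hcs.le).aestronglyMeasurable.neg
  · filter_upwards [ae_restrict_mem measurableSet_Ioi] with t ht z hz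
    have ht' : 0 < t := ht
    have hz' : c.re < z.re := hz
    rw [norm_neg, norm_smul, norm_smul (Complex.exp _)]
    gcongr
    rw [Complex.norm_exp, Complex.norm_exp, Real.exp_le_exp]
    simp only [Complex.neg_re, Complex.mul_re, Complex.ofReal_re, Complex.ofReal_im, mul_zero,
      sub_zero]
    nlinarith
  · refine ae_of_all _ fun t z _ => ?_
    have h : HasDerivAt (fun z : ℂ => -(z * t)) (-(t : ℂ)) z := by
      simpa using ((hasDerivAt_id z).mul_const (t : ℂ)).fun_neg
    simpa only [mul_neg, neg_smul, smul_smul] using h.cexp.smul_const (g t)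

/-- Two vertical line integrals of a holomorphic function that decays quadratically in the strip
between them agree. -/
theorem integral_vertical_line_eq [CompleteSpace X] {G : ℂ → X} {a b C : ℝ} (hab : a ≤ b)
    (hG : DifferentiableOn ℂ G {s | s.re ∈ Icc a b})
    (hC : ∀ s : ℂ, s.re ∈ Icc a b → ‖G s‖ ≤ C * (1 + s.im ^ 2)⁻¹) :
    ∫ ξ : ℝ, G (a + ξ * Complex.I) = ∫ ξ : ℝ, G (b + ξ * Complex.I) := by
  have hint (c : ℝ) (hc : c ∈ Icc a b) : Integrable fun ξ : ℝ => G (c + ξ * Complex.I) := by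
    refine Integrable.mono' (integrable_inv_one_add_sq.const_mul C) ?_ ?_
    · refine Continuous.aestronglyMeasurable (continuousOn_univ.mp ?_)
      exact hG.continuousOn.comp (by fun_prop) fun ξ _ => by simpa using hc
    · exact ae_of_all _ fun ξ => by simpa using hC (c + ξ * Complex.I) (by simpa using hc)
  have hlim (c : ℝ) (hc : c ∈ Icc a b) :
      Tendsto (fun R : ℝ => ∫ ξ in (-R)..R, G (c + ξ * Complex.I)) atTop
        (nhds (∫ ξ : ℝ, G (c + ξ * Complex.I))) :=
    intervalIntegral_tendsto_integral (hint c hc) tendsto_neg_atTop_atBot tendsto_id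
  have hdecay : Tendsto (fun R : ℝ => C * (1 + R ^ 2)⁻¹ * |b - a|) atTop (nhds 0) := by
    have : Tendsto (fun R : ℝ => (1 + R ^ 2)⁻¹) atTop (nhds 0) :=
      (tendsto_atTop_add_const_left _ _ (tendsto_pow_atTop two_ne_zero)).inv_tendsto_atTop
    simpa using (this.const_mul C).mul_const |b - a|
  have hhor (e : ℝ) (he : e ^ 2 = 1) :
      Tendsto (fun R : ℝ => ∫ x in a..b, G (x + (e * R : ℝ) * Complex.I)) atTop (nhds 0) := by
    refine squeeze_zero_norm (fun R => ?_) hdecay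
    refine intervalIntegral.norm_integral_le_of_norm_le_const fun x hx => ?_
    rw [uIoc_of_le hab] at hx
    have := hC (x + (e * R : ℝ) * Complex.I) (by simpa using ⟨hx.1.le, hx.2⟩)
    simpa [mul_pow, he] using this
  have hrect (R : ℝ) := Complex.integral_boundary_rect_eq_zero_of_differentiableOn G
    (a + (-R : ℝ) * Complex.I) (b + R * Complex.I) (hG.mono fun s hs => by
      have := hs.1
      simpa [uIcc_of_le hab] using this)
  have hsum := (((hhor (-1) (by norm_num)).sub (hhor 1 (by norm_num))).add
    ((hlim b ⟨hab, le_rfl⟩).const_smul Complex.I)).sub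
    ((hlim a ⟨le_rfl, hab⟩).const_smul Complex.I)
  have hzero : Tendsto (fun _ : ℝ => (0 : X)) atTop (nhds 0) := tendsto_const_nhds
  have := tendsto_nhds_unique (hsum.congr fun R => by simpa using hrect R) hzero
  rw [sub_zero, zero_add, ← smul_sub, smul_eq_zero_iff_right Complex.I_ne_zero, sub_eq_zero] at this
  exact this.symm

theorem eq_integral_exp_smul_laplaceTransform [CompleteSpace X] {u : ℝ → X} {c t : ℝ} (ht : 0 < t)
    (hu : IntegrableOn (fun t : ℝ => Complex.exp (-((c : ℂ) * t)) • u t) (Ioi 0))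
    (hcont : ContinuousAt u t)
    (hint : Integrable fun ξ : ℝ => laplaceTransform u (c + ξ * Complex.I)) :
    u t = (2 * Real.pi)⁻¹ • ∫ ξ : ℝ, Complex.exp ((c + ξ * Complex.I) * t) •
      laplaceTransform u (c + ξ * Complex.I) := by
  set g : ℝ → X := (Ioi (0 : ℝ)).indicator fun t : ℝ => Complex.exp (-((c : ℂ) * t)) • u t with hg
  have hgint : Integrable g := (integrable_indicator_iff measurableSet_Ioi).mpr hu
  have hfour (ξ : ℝ) : FourierTransform.fourier g ξ =
      laplaceTransform u (c + ((2 * Real.pi) * ξ : ℝ) * Complex.I) := by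
    rw [Real.fourier_eq', laplaceTransform, ← integral_indicator measurableSet_Ioi]
    congr 1 with v
    by_cases hv : v ∈ Ioi (0 : ℝ)
    · rw [hg, indicator_of_mem hv, indicator_of_mem hv, smul_smul, ← Complex.exp_add]
      congr 2
      simp
      ring
    · rw [hg, indicator_of_notMem hv, indicator_of_notMem hv, smul_zero]
  have h2pi : (2 * Real.pi) ≠ 0 := by positivity
  have hfint : Integrable (FourierTransform.fourier g) := by
    rw [show FourierTransform.fourier g = fun ξ => _ from funext hfour]
    exact hint.comp_mul_left' h2pi
  have hgc : ContinuousAt g t := by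
    refine ContinuousAt.congr (f := fun t : ℝ => Complex.exp (-((c : ℂ) * t)) • u t)
      (by fun_prop) ?_
    filter_upwards [Ioi_mem_nhds ht] with v hv
    rw [hg, indicator_of_mem hv]
  have hinv := hgint.fourierInv_fourier_eq hfint hgc
  rw [Real.fourierInv_eq'] at hinv
  have hgt : u t = Complex.exp (c * t) • g t := by
    rw [hg, indicator_of_mem (show t ∈ Ioi (0:ℝ) from ht), smul_smul, ← Complex.exp_add]
    simp
  rw [hgt, ← hinv, ← integral_smul]
  have := Measure.integral_comp_mul_left (fun ξ : ℝ => Complex.exp ((c + ξ * Complex.I) * t) •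
      laplaceTransform u (c + ξ * Complex.I)) (2 * Real.pi)
  rw [abs_of_pos (by positivity)] at this
  rw [← this]
  congr 1 with ξ
  rw [hfour, smul_smul, ← Complex.exp_add]
  congr 2
  simp
  ring

end LaplaceTransform

section Volterra
variable {V : Type*} [NormedAddCommGroup V] [NormedSpace ℂ V]

theorem norm_volterra_rhs_le {A : V →L[ℂ] V} {K : ℝ → V →L[ℂ] V} {y : ℝ → V} {S ω x : ℝ}
    (hK : IntegrableOn K (Ioi 0)) (hω : 0 ≤ ω) (hS : 0 ≤ S) (hx : 0 ≤ x)
    (hy : ∀ τ ∈ Icc 0 x, ‖y τ‖ ≤ S * Real.exp (ω * τ)) :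
    ‖A (y x) + ∫ τ in (0 : ℝ)..x, K τ (y (x - τ))‖ ≤
      (‖A‖ + ∫ t in Ioi (0 : ℝ), ‖K t‖) * S * Real.exp (ω * x) := by
  have h1 : ‖A (y x)‖ ≤ ‖A‖ * (S * Real.exp (ω * x)) :=
    (A.le_opNorm _).trans (mul_le_mul_of_nonneg_left (hy x ⟨hx, le_rfl⟩) (norm_nonneg _))
  have h2 : ‖∫ τ in (0 : ℝ)..x, K τ (y (x - τ))‖ ≤
      (∫ t in Ioi (0 : ℝ), ‖K t‖) * (S * Real.exp (ω * x)) := by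
    rw [intervalIntegral.integral_of_le hx, ← integral_mul_const]
    have hKS : IntegrableOn (fun t => ‖K t‖ * (S * Real.exp (ω * x))) (Ioi 0) :=
      hK.norm.mul_const _
    refine (norm_integral_le_of_norm_le (hKS.mono_set Ioc_subset_Ioi_self) ?_).trans
      (setIntegral_mono_set hKS (ae_of_all _ fun t => by positivity)
        Ioc_subset_Ioi_self.eventuallyLE)
    filter_upwards [ae_restrict_mem measurableSet_Ioc] with τ hτ
    refine ((K τ).le_opNorm _).trans (mul_le_mul_of_nonneg_left ?_ (norm_nonneg _))
    refine (hy (x - τ) ⟨by linarith [hτ.2], by linarith [hτ.1]⟩).trans ?_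
    have := hτ.1.le
    gcongr
    linarith
  refine (norm_add_le _ _).trans ((add_le_add h1 h2).trans_eq (by ring))

theorem exists_exp_bound_of_volterra {A : V →L[ℂ] V} {K : ℝ → V →L[ℂ] V} {y : ℝ → V}
    (hK : IntegrableOn K (Ioi 0))
    (hy : ∀ t ≥ (0 : ℝ), HasDerivWithinAt y
      (A (y t) + ∫ τ in (0 : ℝ)..t, K τ (y (t - τ))) (Ici 0) t) :
    ∃ ω ≥ 0, ∀ t ≥ (0 : ℝ), ‖y t‖ ≤ 2 * ‖y 0‖ * Real.exp (ω * t) := by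
  set M := ‖A‖ + ∫ t in Ioi (0 : ℝ), ‖K t‖
  have hM : 0 ≤ M := add_nonneg (norm_nonneg _) (integral_nonneg fun _ => norm_nonneg _)
  set ω := 2 * M + 1 with hω
  have hω0 : 0 < ω := by positivity
  refine ⟨ω, hω0.le, fun T hT => ?_⟩
  have hycont : ContinuousOn y (Icc 0 T) := fun t ht =>
    ((hy t ht.1).continuousWithinAt).mono Icc_subset_Ici_self
  obtain ⟨p, hp, hmax⟩ := isCompact_Icc.exists_isMaxOn (nonempty_Icc.mpr hT)
    (f := fun t => ‖y t‖ * Real.exp (-(ω * t))) (by fun_prop)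
  set S := ‖y p‖ * Real.exp (-(ω * p)) with hSdef
  have hS0 : 0 ≤ S := by positivity
  have hyS (t) (ht : t ∈ Icc 0 T) : ‖y t‖ ≤ S * Real.exp (ω * t) := by
    have h : ‖y t‖ * Real.exp (-(ω * t)) ≤ S := hmax ht
    rwa [Real.exp_neg, ← div_eq_mul_inv, div_le_iff₀ (Real.exp_pos _)] at h
  have hbound := image_norm_le_of_norm_deriv_right_le_deriv_boundary
    (f' := fun t => A (y t) + ∫ τ in (0 : ℝ)..t, K τ (y (t - τ))) (a := 0) (b := T)
    (B := fun t => ‖y 0‖ + M * S / ω * Real.exp (ω * t))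
    (B' := fun t => M * S * Real.exp (ω * t)) hycont
    (fun x hx => (hy x hx.1).mono (Ici_subset_Ici.mpr hx.1))
    (le_add_of_nonneg_right (by positivity))
    (fun x => by
      have h : HasDerivAt (fun x => ω * x) ω x := by simpa using (hasDerivAt_id x).const_mul ω
      exact ((h.exp.const_mul (M * S / ω)).const_add ‖y 0‖).congr_deriv (by field_simp))
    (fun x hx => norm_volterra_rhs_le hK hω0.le hS0 hx.1 fun τ hτ =>
      hyS τ ⟨hτ.1, hτ.2.trans hx.2.le⟩)
  have hS : S ≤ 2 * ‖y 0‖ := by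
    have h1 : S ≤ (‖y 0‖ + M * S / ω * Real.exp (ω * p)) * Real.exp (-(ω * p)) :=
      mul_le_mul_of_nonneg_right (hbound hp) (Real.exp_pos _).le
    rw [add_mul, mul_assoc, ← Real.exp_add, add_neg_cancel, Real.exp_zero, mul_one] at h1
    have h2 : ‖y 0‖ * Real.exp (-(ω * p)) ≤ ‖y 0‖ :=
      mul_le_of_le_one_right (norm_nonneg _) (Real.exp_le_one_iff.mpr (by
        have := mul_nonneg hω0.le hp.1
        linarith))
    have h3 : M * S / ω ≤ S / 2 := by
      rw [div_le_div_iff₀ hω0 two_pos, hω]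
      nlinarith
    linarith
  exact (hyS T ⟨hT, le_rfl⟩).trans (by gcongr)

theorem laplaceTransform_volterra [CompleteSpace V] {A : V →L[ℂ] V} {K : ℝ → V →L[ℂ] V}
    {y : ℝ → V} {C ω : ℝ} {s : ℂ} (hK : IntegrableOn K (Ioi 0)) (hω : 0 ≤ ω)
    (hyω : ∀ t ≥ (0 : ℝ), ‖y t‖ ≤ C * Real.exp (ω * t)) (hs : ω < s.re)
    (hyint : IntegrableOn (fun t : ℝ => Complex.exp (-(s * t)) • y t) (Ioi 0))
    (hy : ∀ t ≥ (0 : ℝ), HasDerivWithinAt y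
      (A (y t) + ∫ τ in (0 : ℝ)..t, K τ (y (t - τ))) (Ici 0) t) :
    s • laplaceTransform y s - (A + laplaceTransform K s) (laplaceTransform y s) = y 0 := by
  have hKs : IntegrableOn (fun t : ℝ => Complex.exp (-(s * t)) • K t) (Ioi 0) :=
    integrableOn_exp_smul_of_re_le (c := 0) (by simpa using hK) (by simpa using hω.trans hs.le)
  let L : (V →L[ℂ] V) →L[ℝ] V →L[ℝ] V :=
    (ContinuousLinearMap.id ℂ (V →L[ℂ] V)).bilinearRestrictScalars ℝ
  have hconv (x : ℝ) : ∫ τ in (0 : ℝ)..x, L (Complex.exp (-(s * τ)) • K τ)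
      (Complex.exp (-(s * (x - τ : ℝ))) • y (x - τ)) =
      Complex.exp (-(s * x)) • ∫ τ in (0 : ℝ)..x, K τ (y (x - τ)) := by
    rw [← intervalIntegral.integral_smul]
    congr 1 with τ
    simp only [L, ContinuousLinearMap.bilinearRestrictScalars_apply_apply,
      ContinuousLinearMap.id_apply, smul_apply, map_smul, smul_smul, ← Complex.exp_add]
    congr 2
    push_cast
    ring
  have hconvint : IntegrableOn (fun x : ℝ => Complex.exp (-(s * x)) •
      ∫ τ in (0 : ℝ)..x, K τ (y (x - τ))) (Ioi 0) := by
    have h := integrable_posConvolution (μ := volume) (ν := volume) hKs hyint L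
    rw [posConvolution, integrable_indicator_iff measurableSet_Ioi] at h
    exact h.congr_fun (fun x _ => hconv x) measurableSet_Ioi
  have hconvval := integral_posConvolution (μ := volume) (ν := volume) hKs hyint L
  simp only [hconv] at hconvval
  have hAint : IntegrableOn (fun t : ℝ => Complex.exp (-(s * t)) • A (y t)) (Ioi 0) := by
    simpa [IntegrableOn] using A.integrable_comp hyint
  have hAval : ∫ t in Ioi (0 : ℝ), Complex.exp (-(s * t)) • A (y t) =
      A (laplaceTransform y s) := by
    simpa [laplaceTransform] using A.integral_comp_comm hyint
  have hexp (t : ℝ) : HasDerivAt (fun t : ℝ => Complex.exp (-(s * t)))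
      (Complex.exp (-(s * t)) * -s) t := by
    have h : HasDerivAt (fun z : ℂ => -(s * z)) (-s) (t : ℂ) := by
      simpa using ((hasDerivAt_id (t : ℂ)).const_mul s).fun_neg
    exact h.cexp.comp_ofReal
  have hlim : Tendsto (fun t : ℝ => Complex.exp (-(s * t)) • y t) atTop (nhds 0) := by
    have hdecay : Tendsto (fun t : ℝ => C * Real.exp (-((s.re - ω) * t))) atTop (nhds 0) := by
      simpa using (Real.tendsto_exp_neg_atTop_nhds_zero.comp
        (tendsto_id.const_mul_atTop (sub_pos.mpr hs))).const_mul C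
    refine squeeze_zero_norm' ?_ hdecay
    filter_upwards [eventually_ge_atTop 0] with t ht
    rw [norm_smul, Complex.norm_exp]
    refine (mul_le_mul_of_nonneg_left (hyω t ht) (Real.exp_pos _).le).trans_eq ?_
    rw [mul_left_comm, ← Real.exp_add]
    congr 2
    simp
    ring
  have hFTC := integral_Ioi_of_hasDerivAt_of_tendsto (a := 0)
    (f := fun t : ℝ => Complex.exp (-(s * t)) • y t)
    (f' := fun t : ℝ => (Complex.exp (-(s * t)) • A (y t) + Complex.exp (-(s * t)) •
      ∫ τ in (0 : ℝ)..t, K τ (y (t - τ))) - s • Complex.exp (-(s * t)) • y t)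
    ((hexp 0).continuousAt.continuousWithinAt.smul (hy 0 le_rfl).continuousWithinAt)
    (fun t ht => by
      have h := (hexp t).fun_smul ((hy t (le_of_lt ht)).hasDerivAt (Ici_mem_nhds ht))
      convert h using 1
      rw [smul_add, smul_smul, mul_comm s (Complex.exp _), mul_neg, neg_smul, sub_eq_add_neg])
    ((hAint.add hconvint).sub (hyint.smul s)) hlim
  rw [integral_sub (by exact hAint.add hconvint) (by exact hyint.smul s),
    integral_add hAint hconvint, hAval, hconvval, integral_smul] at hFTC
  have hval : L (∫ t in Ioi (0 : ℝ), Complex.exp (-(s * t)) • K t)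
      (∫ t in Ioi (0 : ℝ), Complex.exp (-(s * t)) • y t) =
      laplaceTransform K s (laplaceTransform y s) := rfl
  rw [hval, ← laplaceTransform] at hFTC
  simp only [Complex.ofReal_zero, mul_zero, neg_zero, Complex.exp_zero, one_smul, zero_sub] at hFTC
  rw [add_apply, ← neg_sub, hFTC, neg_neg]

theorem exists_differentiableOn_resolvent [FiniteDimensional ℂ V] {D : ℂ → V →L[ℂ] V}
    {D' : ℂ → V →L[ℂ] V} {δ Q : ℝ} (hδ : 0 < δ)
    (hD : ∀ s : ℂ, 0 < s.re → HasDerivAt D (D' s) s) (hD' : ∀ s : ℂ, 0 < s.re → ‖D' s‖ ≤ Q)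
    (hlow : ∀ s : ℂ, 0 < s.re → ∀ v, δ * (1 + ‖s‖) * ‖v‖ ≤ ‖D s v‖) (w : V) :
    ∃ f : ℂ → V, DifferentiableOn ℂ f {s | 0 < s.re} ∧ (∀ s : ℂ, 0 < s.re → D s (f s) = w) ∧
      ∀ s : ℂ, 0 < s.re → ‖deriv f s‖ ≤ Q * ‖w‖ / δ ^ 2 * (1 + s.im ^ 2)⁻¹ := by
  have : CompleteSpace V := FiniteDimensional.complete ℂ V
  have hδs (s : ℂ) : 0 < δ * (1 + ‖s‖) := by positivity
  have hinj (s : ℂ) (hs : 0 < s.re) : Function.Injective (D s) := by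
    refine (injective_iff_map_eq_zero (D s)).mpr fun v hv => ?_
    have h := hlow s hs v
    rw [hv, norm_zero] at h
    exact norm_le_zero_iff.mp (nonpos_of_mul_nonpos_right h (hδs s))
  have hunit (s : ℂ) (hs : 0 < s.re) : IsUnit (D s) :=
    ContinuousLinearMap.isUnit_iff_bijective.mpr
      ⟨hinj s hs, (LinearMap.injective_iff_surjective (f := (D s : V →ₗ[ℂ] V))).mp (hinj s hs)⟩
  have hDf (s : ℂ) (hs : 0 < s.re) : D s (Ring.inverse (D s) w) = w := by
    have h := Ring.mul_inverse_cancel _ (hunit s hs)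
    exact congrArg (fun T : V →L[ℂ] V => T w) h
  have hfdiff (s : ℂ) (hs : 0 < s.re) :
      DifferentiableAt ℂ (fun s => Ring.inverse (D s) w) s := by
    have h : DifferentiableAt ℂ (Ring.inverse ∘ D) s :=
      (differentiableAt_inverse (𝕜 := ℂ) (hunit s hs)).comp s (hD s hs).differentiableAt
    exact h.clm_apply (differentiableAt_const w)
  refine ⟨fun s => Ring.inverse (D s) w, fun s hs => (hfdiff s hs).differentiableWithinAt, hDf,
    fun s hs => ?_⟩
  set f : ℂ → V := fun s => Ring.inverse (D s) w
  have hprod : D' s (f s) + D s (deriv f s) = 0 := by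
    have h1 := (hD s hs).clm_apply (hfdiff s hs).hasDerivAt
    have h2 : HasDerivAt (fun z => D z (f z)) 0 s := by
      refine (hasDerivAt_const s w).congr_of_eventuallyEq ?_
      filter_upwards [(isOpen_lt continuous_const Complex.continuous_re).mem_nhds hs] with z hz
      exact hDf z hz
    exact h1.unique h2
  have h1 : δ * (1 + ‖s‖) * ‖f s‖ ≤ ‖w‖ := (hlow s hs (f s)).trans_eq (by rw [hDf s hs])
  have h2 : δ * (1 + ‖s‖) * ‖deriv f s‖ ≤ Q * ‖f s‖ := by
    refine (hlow s hs _).trans ?_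
    rw [eq_neg_of_add_eq_zero_right hprod, norm_neg]
    exact ((D' s).le_opNorm _).trans (mul_le_mul_of_nonneg_right (hD' s hs) (norm_nonneg _))
  have hQ : 0 ≤ Q := (norm_nonneg _).trans (hD' s hs)
  have h3 : (δ * (1 + ‖s‖)) ^ 2 * ‖deriv f s‖ ≤ Q * ‖w‖ := by
    have h4 := mul_le_mul_of_nonneg_left h2 (hδs s).le
    have h5 := mul_le_mul_of_nonneg_left h1 hQ
    nlinarith
  have h6 : 1 + s.im ^ 2 ≤ (1 + ‖s‖) ^ 2 := by
    have := Complex.abs_im_le_norm s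
    have := sq_abs s.im
    nlinarith [abs_nonneg s.im, norm_nonneg s]
  rw [← div_eq_mul_inv, div_div, le_div_iff₀ (by positivity)]
  refine le_trans ?_ h3
  rw [mul_comm, mul_pow]
  gcongr

theorem norm_laplaceTransform_le {X : Type*} [NormedAddCommGroup X] [NormedSpace ℂ X]
    {g : ℝ → X} (hg : IntegrableOn g (Ioi 0)) {s : ℂ} (hs : 0 ≤ s.re) :
    ‖laplaceTransform g s‖ ≤ ∫ t in Ioi (0 : ℝ), ‖g t‖ := by
  refine norm_integral_le_of_norm_le hg.norm ?_
  filter_upwards [ae_restrict_mem measurableSet_Ioi] with t ht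
  have ht' : 0 < t := ht
  rw [norm_smul, Complex.norm_exp]
  refine mul_le_of_le_one_left (norm_nonneg _) (Real.exp_le_one_iff.mpr ?_)
  simp only [Complex.neg_re, Complex.mul_re, Complex.ofReal_re, Complex.ofReal_im, mul_zero,
    sub_zero]
  nlinarith

/-- Solutions of a linear Volterra integro-differential equation decay like `1 / t` if the kernel
has a finite first moment and the characteristic operator is uniformly invertible on the right
half-plane. -/
theorem tendsto_zero_of_volterra [FiniteDimensional ℂ V] {A : V →L[ℂ] V} {K : ℝ → V →L[ℂ] V}
    {y : ℝ → V} {δ : ℝ} (hδ : 0 < δ) (hK : IntegrableOn K (Ioi 0))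
    (hK' : IntegrableOn (fun t : ℝ => (t : ℂ) • K t) (Ioi 0))
    (hlow : ∀ s : ℂ, 0 < s.re → ∀ v,
      δ * (1 + ‖s‖) * ‖v‖ ≤ ‖s • v - (A + laplaceTransform K s) v‖)
    (hy : ∀ t ≥ (0 : ℝ), HasDerivWithinAt y
      (A (y t) + ∫ τ in (0 : ℝ)..t, K τ (y (t - τ))) (Ici 0) t) :
    Tendsto y atTop (nhds 0) := by
  have : CompleteSpace V := FiniteDimensional.complete ℂ V
  obtain ⟨ω, hω, hyω⟩ := exists_exp_bound_of_volterra hK hy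
  have hycont : ContinuousOn y (Ici 0) := fun t ht => (hy t ht).continuousWithinAt
  set D : ℂ → V →L[ℂ] V := fun s =>
    s • ContinuousLinearMap.id ℂ V - (A + laplaceTransform K s) with hDdef
  set D' : ℂ → V →L[ℂ] V := fun s =>
    ContinuousLinearMap.id ℂ V + laplaceTransform (fun t => (t : ℂ) • K t) s with hD'def
  have hD (s : ℂ) (hs : 0 < s.re) : HasDerivAt D (D' s) s := by
    have h1 := hasDerivAt_laplaceTransform (g := K) (c := 0) (s := s) (by simpa using hK)
      (by simpa using hK') (by simpa using hs)
    have h2 := (hasDerivAt_id s).smul_const (ContinuousLinearMap.id ℂ V)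
    exact (h2.fun_sub (h1.const_add A)).congr_deriv (by simp [hD'def])
  obtain ⟨f, hfdiff, hDf, hfbound⟩ := exists_differentiableOn_resolvent (D := D) (D' := D')
    (Q := 1 + ∫ t in Ioi (0 : ℝ), ‖(t : ℂ) • K t‖) hδ hD
    (fun s hs => (norm_add_le _ _).trans
      (add_le_add ContinuousLinearMap.norm_id_le (norm_laplaceTransform_le hK' hs.le)))
    (fun s hs v => by simpa [hDdef] using hlow s hs v) (y 0)
  set C := (1 + ∫ t in Ioi (0 : ℝ), ‖(t : ℂ) • K t‖) * ‖y 0‖ / δ ^ 2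
  have hC : 0 ≤ C := by
    have : 0 ≤ ∫ t in Ioi (0 : ℝ), ‖(t : ℂ) • K t‖ := integral_nonneg fun _ => norm_nonneg _
    positivity
  have hopen : IsOpen {s : ℂ | 0 < s.re} := isOpen_lt continuous_const Complex.continuous_re
  have hf'diff : DifferentiableOn ℂ (deriv f) {s | 0 < s.re} := hfdiff.deriv hopen
  have hint0 : IntegrableOn (fun t : ℝ => Complex.exp (-(((ω + 2 : ℝ) : ℂ) * t)) • y t)
      (Ioi 0) := by
    exact integrableOn_exp_smul_of_norm_le (hycont.mono Ioi_subset_Ici_self)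
      (fun t ht => hyω t (le_of_lt ht)) (by simp)
  have hint1 : IntegrableOn (fun t : ℝ => Complex.exp (-(((ω + 2 : ℝ) : ℂ) * t)) •
      (t : ℂ) • y t) (Ioi 0) := by
    refine integrableOn_exp_smul_of_norm_le (C := 2 * ‖y 0‖) (a := ω + 1)
      (ContinuousOn.smul (by fun_prop) (hycont.mono Ioi_subset_Ici_self)) (fun t ht => ?_) (by simp)
    have ht' : 0 < t := ht
    rw [norm_smul, Complex.norm_of_nonneg ht'.le, add_mul, Real.exp_add]
    have h1 := hyω t ht'.le
    have h2 : t ≤ Real.exp (1 * t) := by linarith [Real.add_one_le_exp (1 * t)]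
    calc t * ‖y t‖ ≤ Real.exp (1 * t) * (2 * ‖y 0‖ * Real.exp (ω * t)) := by gcongr
      _ = _ := by ring
  have hYf (s : ℂ) (hs : ω + 2 ≤ s.re) : laplaceTransform y s = f s := by
    have hs0 : 0 < s.re := by linarith
    have h1 := laplaceTransform_volterra hK hω hyω (s := s) (by linarith)
      (integrableOn_exp_smul_of_re_le hint0 (by simpa using hs)) hy
    have h2 := hDf s hs0
    have h3 : D s (laplaceTransform y s) = y 0 := by simpa [hDdef] using h1
    have h4 := hlow s hs0 (laplaceTransform y s - f s)
    have h5 : s • (laplaceTransform y s - f s) -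
        (A + laplaceTransform K s) (laplaceTransform y s - f s) = 0 := by
      have : D s (laplaceTransform y s - f s) = 0 := by rw [map_sub, h2, h3, sub_self]
      simpa [hDdef] using this
    rw [h5, norm_zero] at h4
    exact sub_eq_zero.mp (norm_le_zero_iff.mp (nonpos_of_mul_nonpos_right h4 (by positivity)))
  have hWf (s : ℂ) (hs : ω + 2 < s.re) :
      laplaceTransform (fun t => (t : ℂ) • y t) s = -deriv f s := by
    have h1 := hasDerivAt_laplaceTransform (s := s) hint0 hint1 (by simpa using hs)
    have h2 : HasDerivAt f (-laplaceTransform (fun t => (t : ℂ) • y t) s) s := by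
      refine h1.congr_of_eventuallyEq ?_
      filter_upwards [(isOpen_lt continuous_const Complex.continuous_re).mem_nhds hs] with z hz
      exact (hYf z (le_of_lt hz)).symm
    rw [h2.deriv, neg_neg]
  set b := ω + 3 with hb
  have hline (c : ℝ) (hc : 0 < c) : Integrable fun ξ : ℝ => deriv f (c + ξ * Complex.I) := by
    refine Integrable.mono' (integrable_inv_one_add_sq.const_mul C) ?_ ?_
    · refine Continuous.aestronglyMeasurable (continuousOn_univ.mp ?_)
      exact hf'diff.continuousOn.comp (by fun_prop) fun ξ _ => by simpa using hc
    · exact ae_of_all _ fun ξ => by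
        simpa using hfbound (c + ξ * Complex.I) (by simpa using hc)
  have hbW (ξ : ℝ) : laplaceTransform (fun t => (t : ℂ) • y t) (b + ξ * Complex.I) =
      -deriv f (b + ξ * Complex.I) := hWf _ (by norm_num [hb])
  have hbound (t : ℝ) (ht : 0 < t) : ‖(t : ℂ) • y t‖ ≤ C / 2 := by
    have hinv := eq_integral_exp_smul_laplaceTransform (u := fun t => (t : ℂ) • y t) (c := b) ht
      (integrableOn_exp_smul_of_re_le hint1 (by norm_num [hb]))
      ((by fun_prop : ContinuousAt (fun t : ℝ => (t : ℂ)) t).smul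
        (hycont.continuousAt (Ici_mem_nhds ht)))
      (by simpa only [hbW] using (hline b (by linarith)).fun_neg)
    simp only [hbW] at hinv
    have ha (a : ℝ) (ha0 : 0 < a) (hab : a ≤ b) : ‖(t : ℂ) • y t‖ ≤ C / 2 * Real.exp (a * t) := by
      have hnorm (s : ℂ) (hs : 0 < s.re) : ‖Complex.exp (s * t) • -deriv f s‖ ≤
          Real.exp (s.re * t) * (C * (1 + s.im ^ 2)⁻¹) := by
        rw [norm_smul, norm_neg, Complex.norm_exp]
        simp only [Complex.mul_re, Complex.ofReal_re, Complex.ofReal_im, mul_zero, sub_zero]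
        exact mul_le_mul_of_nonneg_left (hfbound s hs) (Real.exp_pos _).le
      have hshift := integral_vertical_line_eq (G := fun s => Complex.exp (s * t) • -deriv f s)
        (C := Real.exp (b * t) * C) hab
        (DifferentiableOn.smul (by fun_prop)
          (hf'diff.mono fun s hs => lt_of_lt_of_le ha0 hs.1).neg)
        (fun s hs => (hnorm s (lt_of_lt_of_le ha0 hs.1)).trans (by
          rw [mul_assoc]
          gcongr
          exact hs.2))
      rw [hinv, ← hshift, norm_smul, Real.norm_of_nonneg (by positivity)]
      have hle : ‖∫ ξ : ℝ, Complex.exp ((a + ξ * Complex.I) * t) •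
          -deriv f (a + ξ * Complex.I)‖ ≤ Real.exp (a * t) * (C * Real.pi) := by
        rw [← integral_univ_inv_one_add_sq, ← integral_const_mul, ← integral_const_mul]
        refine norm_integral_le_of_norm_le
          ((integrable_inv_one_add_sq.const_mul C).const_mul _) (ae_of_all _ fun ξ => ?_)
        simpa using hnorm (a + ξ * Complex.I) (by simpa using ha0)
      refine (mul_le_mul_of_nonneg_left hle (by positivity)).trans_eq ?_
      field_simp
    have hlim : Tendsto (fun a : ℝ => C / 2 * Real.exp (a * t)) (nhdsWithin 0 (Ioi 0))
        (nhds (C / 2)) := by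
      have : ContinuousAt (fun a : ℝ => C / 2 * Real.exp (a * t)) 0 := by fun_prop
      simpa using this.tendsto.mono_left nhdsWithin_le_nhds
    refine ge_of_tendsto hlim ?_
    filter_upwards [Ioc_mem_nhdsGT (show 0 < b by linarith)] with a ha'
    exact ha a ha'.1 ha'.2
  refine squeeze_zero_norm' ?_ (tendsto_const_nhds (x := C / 2).div_atTop tendsto_id)
  filter_upwards [eventually_gt_atTop 0] with t ht
  have h := hbound t ht
  rw [norm_smul, Complex.norm_of_nonneg ht.le] at h
  rw [id, le_div_iff₀ ht]
  linarith

end Volterra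

section Complexification

variable {N : ℕ}

/-- The operator on `ℂ^N` given by a real matrix. -/
noncomputable def complexification (M : Matrix (Fin N) (Fin N) ℝ) :
    EuclideanSpace ℂ (Fin N) →L[ℂ] EuclideanSpace ℂ (Fin N) :=
  Matrix.toEuclideanCLM (𝕜 := ℂ) (M.map Complex.ofReal)

/-- The inclusion of `ℝ^N` into `ℂ^N`. -/
noncomputable def ofRealVec : (Fin N → ℝ) →L[ℝ] EuclideanSpace ℂ (Fin N) :=
  LinearMap.toContinuousLinearMap
    { toFun := fun v => WithLp.toLp 2 fun i => (v i : ℂ)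
      map_add' := fun v w => by ext i; simp
      map_smul' := fun c v => by ext i; simp }

theorem ofRealVec_apply (v : Fin N → ℝ) (i : Fin N) : ofRealVec v i = v i := rfl

theorem complexification_apply (M : Matrix (Fin N) (Fin N) ℝ) (v : EuclideanSpace ℂ (Fin N))
    (i : Fin N) : complexification M v i = ∑ j, (M i j : ℂ) * v j := rfl

theorem complexification_add (M M' : Matrix (Fin N) (Fin N) ℝ) :
    complexification (M + M') = complexification M + complexification M' := by
  ext v i
  simp [complexification_apply, add_mul, Finset.sum_add_distrib]

theorem complexification_smul (c : ℝ) (M : Matrix (Fin N) (Fin N) ℝ) :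
    complexification (c • M) = c • complexification M := by
  ext v i
  simp [complexification_apply, Finset.mul_sum, mul_assoc]

theorem continuous_complexification : Continuous (complexification (N := N)) :=
  LinearMap.continuous_of_finiteDimensional
    { toFun := complexification (N := N)
      map_add' := complexification_add
      map_smul' := complexification_smul }

theorem ofRealVec_mulVec (M : Matrix (Fin N) (Fin N) ℝ) (v : Fin N → ℝ) :
    ofRealVec (M.mulVec v) = complexification M (ofRealVec v) := by
  ext i
  simp [complexification_apply, ofRealVec_apply, Matrix.mulVec, dotProduct]

theorem opNormR_nonneg (M : Matrix (Fin N) (Fin N) ℝ) : 0 ≤ opNormR M := norm_nonneg _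

theorem sum_mulVec_sq_le (M : Matrix (Fin N) (Fin N) ℝ) (x : Fin N → ℝ) :
    ∑ i, (∑ j, M i j * x j) ^ 2 ≤ opNormR M ^ 2 * ∑ i, x i ^ 2 := by
  have h := (LinearMap.toContinuousLinearMap (Matrix.toEuclideanLin M)).le_opNorm
    (WithLp.toLp 2 x)
  have h2 := pow_le_pow_left₀ (norm_nonneg _) h 2
  rw [mul_pow, EuclideanSpace.real_norm_sq_eq, EuclideanSpace.real_norm_sq_eq] at h2
  exact h2

theorem norm_complexification_le (M : Matrix (Fin N) (Fin N) ℝ) :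
    ‖complexification M‖ ≤ opNormR M := by
  refine ContinuousLinearMap.opNorm_le_bound _ (opNormR_nonneg M) fun v => ?_
  refine le_of_sq_le_sq ?_ (mul_nonneg (opNormR_nonneg M) (norm_nonneg v))
  have hnorm (w : EuclideanSpace ℂ (Fin N)) :
      ‖w‖ ^ 2 = ∑ i, (w i).re ^ 2 + ∑ i, (w i).im ^ 2 := by
    rw [EuclideanSpace.norm_sq_eq, ← Finset.sum_add_distrib]
    refine Finset.sum_congr rfl fun i _ => ?_
    rw [Complex.sq_norm, Complex.normSq_apply]
    ring
  have hre := sum_mulVec_sq_le M fun i => (v i).re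
  have him := sum_mulVec_sq_le M fun i => (v i).im
  rw [mul_pow, hnorm, hnorm]
  simp only [complexification_apply, Complex.re_sum, Complex.im_sum, Complex.re_ofReal_mul,
    Complex.im_ofReal_mul]
  linarith

theorem spectrum_complexification (M : Matrix (Fin N) (Fin N) ℝ) :
    spectrum ℂ (complexification M :
      EuclideanSpace ℂ (Fin N) →ₗ[ℂ] EuclideanSpace ℂ (Fin N)) =
      spectrum ℂ (M.map Complex.ofReal) :=
  Matrix.spectrum_toLpLin 2

theorem integral_complexification {F : ℝ → Matrix (Fin N) (Fin N) ℝ} {s : Set ℝ}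
    (hF : IntegrableOn (fun t => complexification (F t)) s) :
    ∫ t in s, complexification (F t) =
      complexification (Matrix.of fun i j => ∫ t in s, F t i j) := by
  apply ContinuousLinearMap.coe_injective
  refine (EuclideanSpace.basisFun (Fin N) ℂ).toBasis.ext fun j => ?_
  ext i
  have hentry (M : Matrix (Fin N) (Fin N) ℝ) :
      EuclideanSpace.proj (𝕜 := ℂ) i (complexification M (EuclideanSpace.single j 1)) = M i j := by
    simp [complexification_apply]
  have h := ContinuousLinearMap.integral_comp_comm (EuclideanSpace.proj (𝕜 := ℂ) i)
    (hF.apply_continuousLinearMap (EuclideanSpace.single j 1))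
  rw [← ContinuousLinearMap.integral_apply hF] at h
  simp only [hentry] at h
  have h2 := hentry (Matrix.of fun i j => ∫ t in s, F t i j)
  simp only [OrthonormalBasis.coe_toBasis, EuclideanSpace.basisFun_apply,
    ContinuousLinearMap.coe_coe]
  refine h.symm.trans (Eq.trans ?_ h2.symm)
  simp [integral_complex_ofReal]

end Complexification

theorem norm_exp_sub_one_le_of_re_nonpos {z : ℂ} (hz : z.re ≤ 0) :
    ‖Complex.exp z - 1‖ ≤ ‖z‖ := by
  have h := (convex_halfSpace_re_le 0).norm_image_sub_le_of_norm_hasDerivWithin_le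
    (f := Complex.exp) (f' := Complex.exp) (C := 1) (x := 0) (y := z)
    (fun w _ => (Complex.hasDerivAt_exp w).hasDerivWithinAt)
    (fun w hw => by simpa [Complex.norm_exp] using hw) (by simp) hz
  simpa using h

theorem norm_laplaceTransform_sub_integral_le {V : Type*} [NormedAddCommGroup V] [NormedSpace ℂ V]
    {g : ℝ → V} {s : ℂ} (hg : IntegrableOn g (Ioi 0))
    (hg' : IntegrableOn (fun t : ℝ => t * ‖g t‖) (Ioi 0)) (hs : 0 ≤ s.re) :
    ‖laplaceTransform g s - ∫ t in Ioi (0 : ℝ), g t‖ ≤ ‖s‖ * ∫ t in Ioi (0 : ℝ), t * ‖g t‖ := by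
  have hexp : IntegrableOn (fun t : ℝ => Complex.exp (-(s * t)) • g t) (Ioi 0) :=
    integrableOn_exp_smul_of_re_le (c := 0) (by simpa using hg) (by simpa using hs)
  rw [laplaceTransform, ← integral_sub hexp hg, ← integral_const_mul]
  refine norm_integral_le_of_norm_le (hg'.const_mul _) ?_
  filter_upwards [ae_restrict_mem measurableSet_Ioi] with t (ht : 0 < t)
  have hsub : Complex.exp (-(s * t)) • g t - g t = (Complex.exp (-(s * t)) - 1) • g t := by
    rw [sub_smul, one_smul]
  rw [hsub, norm_smul, ← mul_assoc]
  refine mul_le_mul_of_nonneg_right ?_ (norm_nonneg _)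
  refine (norm_exp_sub_one_le_of_re_nonpos (by simpa using mul_nonneg hs ht.le)).trans_eq ?_
  simp [abs_of_pos ht]

/-- The smallness condition on the first moment in the form used for the determinant estimate. -/
theorem mul_pow_pred_mul_lt_pow_of_lt_div {N : ℕ} (hN : 1 ≤ N) {M P T r : ℝ} (hM : 0 < M)
    (hP : 0 < P) (hT : 0 ≤ T) (h : T / P < 2 * r ^ N / (N * (2 * M) ^ N * P)) :
    M * (2 * M) ^ (N - 1) * T < r ^ N := by
  obtain ⟨n, rfl⟩ : ∃ n, N = n + 1 := ⟨N - 1, by omega⟩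
  rw [div_lt_div_iff₀ hP (by positivity), pow_succ (2 * M)] at h
  have h2 : P * (2 * ((n + 1 : ℕ) * (M * (2 * M) ^ n * T))) < P * (2 * r ^ (n + 1)) := by
    linarith
  have h3 := lt_of_mul_lt_mul_left (lt_of_mul_lt_mul_left h2 hP.le) zero_le_two
  refine lt_of_le_of_lt ?_ h3
  exact le_mul_of_one_le_left (by positivity) (by exact_mod_cast hN)

/-- A solution of the real Volterra equation solves the complexified one. -/
theorem hasDerivWithinAt_ofRealVec_of_volterra {N : ℕ} {E : Matrix (Fin N) (Fin N) ℝ}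
    {F : ℝ → Matrix (Fin N) (Fin N) ℝ} (hF : ContinuousOn F (Ici 0)) {y : ℝ → Fin N → ℝ}
    (hyc : ContinuousOn y (Ici 0)) {t : ℝ} (ht : 0 ≤ t)
    (hy : HasDerivWithinAt y
      (E.mulVec (y t) + ∫ τ in Icc (0 : ℝ) t, (F (t - τ)).mulVec (y τ)) (Ici 0) t) :
    HasDerivWithinAt (fun t => ofRealVec (y t))
      (complexification E (ofRealVec (y t)) +
        ∫ τ in (0 : ℝ)..t, complexification (F τ) (ofRealVec (y (t - τ)))) (Ici 0) t := by
  have hint : IntegrableOn (fun τ => (F (t - τ)).mulVec (y τ)) (Icc 0 t) := by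
    refine ContinuousOn.integrableOn_Icc ?_
    refine (Continuous.matrix_mulVec continuous_fst continuous_snd).comp_continuousOn
      (f := fun τ => (F (t - τ), y τ)) (ContinuousOn.prodMk ?_ ?_)
    · exact hF.comp (by fun_prop) fun τ hτ => sub_nonneg.mpr hτ.2
    · exact hyc.mono fun τ hτ => hτ.1
  have h := ofRealVec.hasFDerivAt.comp_hasDerivWithinAt t hy
  refine h.congr_deriv ?_
  rw [map_add, ofRealVec_mulVec, ← ContinuousLinearMap.integral_comp_comm _ hint,
    integral_Icc_eq_integral_Ioc, ← intervalIntegral.integral_of_le ht]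
  simp only [ofRealVec_mulVec]
  have hrefl := intervalIntegral.integral_comp_sub_left (a := 0) (b := t)
    (fun τ => complexification (F (t - τ)) (ofRealVec (y τ))) t
  simpa using hrefl.symm

theorem tendsto_zero_of_ofRealVec {N : ℕ} {α : Type*} {l : Filter α} {y : α → Fin N → ℝ}
    (h : Tendsto (fun t => ofRealVec (y t)) l (nhds 0)) : Tendsto y l (nhds 0) := by
  refine tendsto_pi_nhds.mpr fun i => ?_
  have hi := ((Complex.continuous_re.comp (EuclideanSpace.proj (𝕜 := ℂ) i).continuous).tendsto
    0).comp h
  simpa [Function.comp_def, ofRealVec_apply] using hi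

theorem stmt_0 {N : ℕ} (hN : 1 ≤ N) (E : Matrix (Fin N) (Fin N) ℝ)
    (F : ℝ → Matrix (Fin N) (Fin N) ℝ)
    (hFcont : ContinuousOn F (Set.Ici 0))
    (hFint : IntegrableOn (fun t => opNormR (F t)) (Set.Ioi 0))
    (hFtint : IntegrableOn (fun t => t * opNormR (F t)) (Set.Ioi 0))
    (Fplus : ℝ) (hFplus : Fplus = ∫ t in Set.Ioi (0:ℝ), opNormR (F t))
    (hFplusPos : 0 < Fplus)
    (Fhat0 : Matrix (Fin N) (Fin N) ℝ)
    (hFhat0 : Fhat0 = Matrix.of fun i j => ∫ t in Set.Ioi (0:ℝ), F t i j)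
    (hHurwitz : IsHurwitz (E + Fhat0))
    (lam1 : ℂ)
    (hlam1 : lam1 ∈ spectrum ℂ ((E + Fhat0).map Complex.ofReal))
    (hlam1max : ∀ μ ∈ spectrum ℂ ((E + Fhat0).map Complex.ofReal), μ.re ≤ lam1.re)
    (hcond : (∫ t in Set.Ioi (0:ℝ), t * (opNormR (F t) / Fplus)) <
      2 * |lam1.re| ^ N / (N * (2 * opNormR E + 2 * Fplus) ^ N * Fplus))
    (y : ℝ → Fin N → ℝ)
    (hy : ∀ t ≥ (0:ℝ), HasDerivWithinAt y
      (E.mulVec (y t) + ∫ τ in Set.Icc (0:ℝ) t, (F (t - τ)).mulVec (y τ)) (Set.Ici 0) t) :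
    Tendsto y atTop (nhds 0) := by
  set K := fun t => complexification (F t) with hKdef
  set T := ∫ t in Ioi (0 : ℝ), t * opNormR (F t) with hTdef
  have hKcont : ContinuousOn K (Ioi 0) :=
    continuous_complexification.comp_continuousOn (hFcont.mono Ioi_subset_Ici_self)
  have hKmeas : AEStronglyMeasurable K (volume.restrict (Ioi 0)) :=
    hKcont.aestronglyMeasurable measurableSet_Ioi
  have hK : IntegrableOn K (Ioi 0) :=
    Integrable.mono' hFint hKmeas (ae_of_all _ fun t => norm_complexification_le (F t))
  have hK' : IntegrableOn (fun t : ℝ => (t : ℂ) • K t) (Ioi 0) := by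
    refine Integrable.mono' hFtint
      (Complex.continuous_ofReal.aestronglyMeasurable.smul hKmeas) ?_
    filter_upwards [ae_restrict_mem measurableSet_Ioi] with t (ht : 0 < t)
    rw [norm_smul, Complex.norm_of_nonneg ht.le]
    exact mul_le_mul_of_nonneg_left (norm_complexification_le (F t)) ht.le
  have hK'norm : IntegrableOn (fun t : ℝ => t * ‖K t‖) (Ioi 0) := by
    refine hK'.norm.congr ?_
    filter_upwards [ae_restrict_mem measurableSet_Ioi] with t (ht : 0 < t)
    rw [norm_smul, Complex.norm_of_nonneg ht.le]
  have hKnorm : ∫ t in Ioi (0 : ℝ), ‖K t‖ ≤ Fplus :=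
    hFplus ▸ integral_mono hK.norm hFint fun t => norm_complexification_le (F t)
  have hKT : ∫ t in Ioi (0 : ℝ), t * ‖K t‖ ≤ T :=
    setIntegral_mono_on hK'norm hFtint measurableSet_Ioi fun t (ht : 0 < t) =>
      mul_le_mul_of_nonneg_left (norm_complexification_le (F t)) ht.le
  have hT : 0 ≤ T := setIntegral_nonneg measurableSet_Ioi fun t (ht : 0 < t) =>
    mul_nonneg ht.le (opNormR_nonneg _)
  have hM : 0 < opNormR E + Fplus := add_pos_of_nonneg_of_pos (opNormR_nonneg E) hFplusPos
  have hA : complexification (E + Fhat0) = complexification E + ∫ t in Ioi (0 : ℝ), K t := by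
    rw [complexification_add, integral_complexification hK, hFhat0]
  have hbound {L : EuclideanSpace ℂ (Fin N) →L[ℂ] EuclideanSpace ℂ (Fin N)}
      (hL : ‖L‖ ≤ ∫ t in Ioi (0 : ℝ), ‖K t‖) :
      ‖complexification E + L‖ ≤ opNormR E + Fplus :=
    (norm_add_le _ _).trans (add_le_add (norm_complexification_le E) (hL.trans hKnorm))
  have hlam1neg : lam1.re < 0 := hHurwitz lam1 hlam1
  have hmoment : (opNormR E + Fplus) * (2 * (opNormR E + Fplus)) ^ (N - 1) * T < |lam1.re| ^ N := by
    refine mul_pow_pred_mul_lt_pow_of_lt_div hN hM hFplusPos hT ?_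
    have hdiv : ∫ t in Ioi (0 : ℝ), t * (opNormR (F t) / Fplus) = T / Fplus := by
      simp only [← mul_div_assoc]
      exact integral_div _ _
    rw [← hdiv, mul_add]
    exact hcond
  obtain ⟨δ, hδ, hlow⟩ := exists_pos_mul_norm_le_norm_smul_sub
    (complexification (E + Fhat0)) (abs_nonneg lam1.re) hM hT
    (fun μ hμ => by
      rw [spectrum_complexification] at hμ
      rw [abs_of_neg hlam1neg, neg_neg]
      exact hlam1max μ hμ)
    (hA ▸ hbound (norm_integral_le_integral_norm _))
    (by rwa [finrank_euclideanSpace_fin])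
  refine tendsto_zero_of_ofRealVec (tendsto_zero_of_volterra (A := complexification E) (K := K)
    hδ hK hK' (fun s hs v => hlow s _ hs.le (hbound (norm_laplaceTransform_le hK hs.le)) ?_ v)
    fun t ht => hasDerivWithinAt_ofRealVec_of_volterra hFcont
      (fun t ht => (hy t ht).continuousWithinAt) ht (hy t ht))
  rw [hA, add_sub_add_left_eq_sub]
  exact (norm_laplaceTransform_sub_integral_le hK hK'norm hs.le).trans
    (mul_le_mul_of_nonneg_left hKT (norm_nonneg s))
end

section
/- Let N ≥ 1, let E be a real N×N matrix, and let F : [0,∞) → ℝ^{N×N} be continuous with F₊ = ∫₀^∞ ‖F(t)‖ dt < ∞ and ∫₀^∞ t‖F(t)‖ dt < ∞; assume F₊ > 0 and set p_F(t) = ‖F(t)‖/F₊. Suppose E + ∫₀^∞ F(t) dt is Hurwitz with λ₁ its eigenvalue of largest real part, and suppose ∫₀^∞ t·p_F(t) dt < 2|Re(λ₁)|^N / (N·(2‖E‖ + 2F₊)^N · F₊). Then for every s ∈ ℂ with Re(s) ≥ 0, Det(s·I_N − E − F̂(s)) ≠ 0. -/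
open MeasureTheory Set

/-- Entrywise Laplace transform of a matrix-valued function on `[0,∞)`. -/
noncomputable def laplaceM {N : ℕ} (F : ℝ → Matrix (Fin N) (Fin N) ℝ) (s : ℂ) :
    Matrix (Fin N) (Fin N) ℂ :=
  Matrix.of fun i j => ∫ t in Set.Ioi (0:ℝ), Complex.exp (-s * t) * (F t i j)

open scoped Matrix.Norms.L2Operator

/-- All singular values of `M` are at most `‖M‖`, and the smallest one is at most `‖M v‖ / ‖v‖`. -/
theorem norm_det_mul_norm_le_s6 {N : ℕ} (M : Matrix (Fin N) (Fin N) ℂ)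
    (v : EuclideanSpace ℂ (Fin N)) :
    ‖M.det‖ * ‖v‖ ≤ ‖M‖ ^ (N - 1) * ‖Matrix.toEuclideanCLM (𝕜 := ℂ) M v‖ := by
  set T := Matrix.toEuclideanCLM (n := Fin N) (𝕜 := ℂ) M with hT
  have hH : (M.conjTranspose * M).IsHermitian := Matrix.isHermitian_conjTranspose_mul_self M
  set b := hH.eigenvectorBasis
  set l := hH.eigenvalues
  have hbi : ∀ i, T.adjoint (T (b i)) = (l i : ℂ) • b i := by
    intro i
    have h1 : T.adjoint = Matrix.toEuclideanCLM (n := Fin N) (𝕜 := ℂ) M.conjTranspose :=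
      (map_star (Matrix.toEuclideanCLM (n := Fin N) (𝕜 := ℂ)) M).symm
    rw [h1]
    apply (WithLp.ofLp_injective 2)
    have h2 := hH.mulVec_eigenvectorBasis i
    rw [← Matrix.mulVec_mulVec] at h2
    simpa [hT] using h2
  have hsum : ∀ x, ‖T x‖ ^ 2 = ∑ i, l i * ‖inner ℂ (b i) x‖ ^ 2 := by
    intro x
    have h1 : (inner ℂ x (T.adjoint (T x)) : ℂ) = ((‖T x‖ ^ 2 : ℝ) : ℂ) := by
      rw [ContinuousLinearMap.adjoint_inner_right, inner_self_eq_norm_sq_to_K]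
      simp
    have h2 : ∀ i, (inner ℂ (b i) (T.adjoint (T x)) : ℂ) = l i * inner ℂ (b i) x := by
      intro i
      rw [ContinuousLinearMap.adjoint_inner_right, ← ContinuousLinearMap.adjoint_inner_left, hbi,
        inner_smul_left]
      simp
    have h3 : ((‖T x‖ ^ 2 : ℝ) : ℂ) = ((∑ i, l i * ‖inner ℂ (b i) x‖ ^ 2 : ℝ) : ℂ) := by
      rw [← h1, ← b.sum_inner_mul_inner]
      push_cast
      refine Finset.sum_congr rfl fun i _ => ?_
      rw [h2, ← inner_conj_symm x (b i), mul_left_comm, Complex.conj_mul']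
    exact_mod_cast h3
  have hli : ∀ i, l i = ‖T (b i)‖ ^ 2 := by
    intro i
    rw [hsum, Finset.sum_eq_single i]
    · simp
    · intro j _ hj
      simp [b.orthonormal.2 hj]
    · simp
  have hl0 : ∀ i, 0 ≤ l i := fun i => by rw [hli]; positivity
  have hl1 : ∀ i, l i ≤ ‖M‖ ^ 2 := fun i => by
    rw [hli]
    have h := T.le_opNorm (b i)
    rw [b.orthonormal.1 i, mul_one] at h
    exact pow_le_pow_left₀ (norm_nonneg _) h 2
  have hdet : ‖M.det‖ ^ 2 = ∏ i, l i := by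
    have h := hH.det_eq_prod_eigenvalues
    rw [Matrix.det_mul, Matrix.det_conjTranspose, ← starRingEnd_apply, Complex.conj_mul'] at h
    have h' : ((‖M.det‖ ^ 2 : ℝ) : ℂ) = ((∏ i, l i : ℝ) : ℂ) := by
      push_cast
      exact h
    exact_mod_cast h'
  have hsq : (‖M.det‖ * ‖v‖) ^ 2 ≤ (‖M‖ ^ (N - 1) * ‖T v‖) ^ 2 := by
    rw [mul_pow, mul_pow, hdet, hsum, ← b.sum_sq_norm_inner_right v, Finset.mul_sum,
      Finset.mul_sum]
    refine Finset.sum_le_sum fun i _ => ?_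
    rw [← mul_assoc]
    refine mul_le_mul_of_nonneg_right ?_ (by positivity)
    rw [← Finset.prod_erase_mul _ _ (Finset.mem_univ i)]
    refine mul_le_mul_of_nonneg_right ?_ (hl0 i)
    calc ∏ j ∈ Finset.univ.erase i, l j ≤ ∏ j ∈ Finset.univ.erase i, ‖M‖ ^ 2 :=
          Finset.prod_le_prod (fun j _ => hl0 j) (fun j _ => hl1 j)
      _ = (‖M‖ ^ (N - 1)) ^ 2 := by
          rw [Finset.prod_const, Finset.card_erase_of_mem (Finset.mem_univ i), Finset.card_univ,
            Fintype.card_fin, ← pow_mul, ← pow_mul, mul_comm]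
  exact (pow_le_pow_iff_left₀ (by positivity) (by positivity) two_ne_zero).mp hsq

/-- The Euclidean operator norm does not grow under complexification. -/
theorem norm_map_ofReal_le_opNormR {N : ℕ} (A : Matrix (Fin N) (Fin N) ℝ) :
    ‖A.map Complex.ofReal‖ ≤ opNormR A := by
  rw [Matrix.cstar_norm_def]
  refine ContinuousLinearMap.opNorm_le_bound _ (norm_nonneg _) fun x => ?_
  have key : ∀ y : EuclideanSpace ℝ (Fin N),
      ∑ i, (A.mulVec y i) ^ 2 ≤ opNormR A ^ 2 * ∑ i, (y i) ^ 2 := by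
    intro y
    have h := (LinearMap.toContinuousLinearMap (Matrix.toEuclideanLin A)).le_opNorm y
    have h2 := pow_le_pow_left₀ (norm_nonneg _) h 2
    rw [mul_pow, EuclideanSpace.norm_sq_eq, EuclideanSpace.norm_sq_eq] at h2
    simpa [opNormR] using h2
  refine (pow_le_pow_iff_left₀ (norm_nonneg _) (mul_nonneg (norm_nonneg _) (norm_nonneg _))
    two_ne_zero).mp ?_
  rw [mul_pow, EuclideanSpace.norm_sq_eq, EuclideanSpace.norm_sq_eq]
  have h1 := key (WithLp.toLp 2 fun i => (x i).re)
  have h2 := key (WithLp.toLp 2 fun i => (x i).im)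
  have e1 : ∀ i, ‖(Matrix.toEuclideanCLM (𝕜 := ℂ) (A.map Complex.ofReal) x) i‖ ^ 2
      = (A.mulVec (fun i => (x i).re) i) ^ 2 + (A.mulVec (fun i => (x i).im) i) ^ 2 := by
    intro i
    rw [Complex.sq_norm, Complex.normSq_apply]
    simp [Matrix.mulVec, dotProduct, sq]
  have e2 : ∀ i, ‖x i‖ ^ 2 = (x i).re ^ 2 + (x i).im ^ 2 := by
    intro i
    rw [Complex.sq_norm, Complex.normSq_apply]; ring
  simp_rw [e1, e2, Finset.sum_add_distrib, mul_add]
  exact add_le_add h1 h2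

theorem norm_one_sub_exp_neg_le {z : ℂ} (hz : 0 ≤ z.re) : ‖1 - Complex.exp (-z)‖ ≤ ‖z‖ := by
  have h := (convex_halfSpace_re_le 0).norm_image_sub_le_of_norm_hasDerivWithin_le
    (f := Complex.exp) (f' := Complex.exp) (C := 1) (x := -z) (y := 0)
    (fun x _ => (Complex.hasDerivAt_exp x).hasDerivWithinAt)
    (fun x hx => by
      rw [Complex.norm_exp]
      exact Real.exp_le_one_iff.mpr hx) (by simpa using hz) (by simp)
  simpa using h

/-- A lower bound for the characteristic polynomial away from the spectrum. -/
theorem pow_le_norm_det_smul_one_sub {N : ℕ} (A : Matrix (Fin N) (Fin N) ℂ) (s : ℂ) (r : ℝ)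
    (hr : 0 ≤ r) (h : ∀ μ ∈ spectrum ℂ A, r ≤ ‖s - μ‖) :
    r ^ N ≤ ‖(s • (1 : Matrix (Fin N) (Fin N) ℂ) - A).det‖ := by
  have hsplit := IsAlgClosed.splits A.charpoly
  have hdet : (s • (1 : Matrix (Fin N) (Fin N) ℂ) - A).det
      = (A.charpoly.roots.map fun μ => s - μ).prod := by
    rw [Matrix.smul_one_eq_diagonal, ← Matrix.scalar_apply, ← Matrix.eval_charpoly,
      hsplit.eval_eq_prod_roots_of_monic A.charpoly_monic]
  have hcard : A.charpoly.roots.card = N := by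
    rw [← hsplit.natDegree_eq_card_roots, Matrix.charpoly_natDegree_eq_dim, Fintype.card_fin]
  have hroots : ∀ μ ∈ A.charpoly.roots, r ≤ ‖s - μ‖ := fun μ hμ =>
    h μ (Matrix.mem_spectrum_of_isRoot_charpoly (Polynomial.isRoot_of_mem_roots hμ))
  rw [hdet]
  refine (congrArg (r ^ ·) hcard.symm).trans_le ?_
  clear hdet hcard hsplit
  generalize A.charpoly.roots = R at hroots
  induction R using Multiset.induction_on with
  | empty => simp
  | cons a R ih =>
    rw [Multiset.map_cons, Multiset.prod_cons, norm_mul, Multiset.card_cons, pow_succ']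
    exact mul_le_mul (hroots a (Multiset.mem_cons_self a R))
      (ih fun μ hμ => hroots μ (Multiset.mem_cons_of_mem hμ)) (by positivity) (norm_nonneg _)

theorem norm_exp_smul_map_ofReal_le {N : ℕ} (A : Matrix (Fin N) (Fin N) ℝ) {s : ℂ}
    (hs : 0 ≤ s.re) {t : ℝ} (ht : 0 ≤ t) :
    ‖Complex.exp (-s * t) • A.map Complex.ofReal‖ ≤ opNormR A := by
  rw [norm_smul, Complex.norm_exp]
  have h1 : Real.exp (-s * t : ℂ).re ≤ 1 := by
    refine Real.exp_le_one_iff.mpr ?_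
    simpa using mul_nonneg hs ht
  exact (mul_le_of_le_one_left (norm_nonneg _) h1).trans (norm_map_ofReal_le_opNormR _)

theorem integrable_smul_map_ofReal {N : ℕ} {F : ℝ → Matrix (Fin N) (Fin N) ℝ}
    (hFcont : ContinuousOn F (Set.Ici 0))
    (hFint : IntegrableOn (fun t => opNormR (F t)) (Set.Ioi 0)) {s : ℂ} (hs : 0 ≤ s.re) :
    IntegrableOn (fun t : ℝ => Complex.exp (-s * t) • (F t).map Complex.ofReal) (Set.Ioi 0) := by
  have hcont : ContinuousOn (fun t : ℝ => Complex.exp (-s * t) • (F t).map Complex.ofReal)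
      (Set.Ioi 0) := by
    have hexp : Continuous fun t : ℝ => Complex.exp (-s * t) := by fun_prop
    exact hexp.continuousOn.smul <| (Continuous.matrix_map continuous_id Complex.continuous_ofReal).comp_continuousOn
      (hFcont.mono Set.Ioi_subset_Ici_self)
  refine Integrable.mono' hFint (hcont.aestronglyMeasurable measurableSet_Ioi) ?_
  refine (ae_restrict_iff' measurableSet_Ioi).mpr (.of_forall fun t ht => ?_)
  exact norm_exp_smul_map_ofReal_le (F t) hs (le_of_lt ht)

theorem laplaceM_eq_integral {N : ℕ} {F : ℝ → Matrix (Fin N) (Fin N) ℝ}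
    (hFcont : ContinuousOn F (Set.Ici 0))
    (hFint : IntegrableOn (fun t => opNormR (F t)) (Set.Ioi 0)) {s : ℂ} (hs : 0 ≤ s.re) :
    laplaceM F s = ∫ t in Set.Ioi (0:ℝ), Complex.exp (-s * t) • (F t).map Complex.ofReal := by
  ext i j
  have h := (Matrix.entryLinearMap ℂ ℂ i j : Matrix (Fin N) (Fin N) ℂ →ₗ[ℂ] ℂ
    ).toContinuousLinearMap.integral_comp_comm (integrable_smul_map_ofReal hFcont hFint hs)
  simpa [laplaceM] using h

theorem norm_laplaceM_le {N : ℕ} {F : ℝ → Matrix (Fin N) (Fin N) ℝ}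
    (hFcont : ContinuousOn F (Set.Ici 0))
    (hFint : IntegrableOn (fun t => opNormR (F t)) (Set.Ioi 0)) {s : ℂ} (hs : 0 ≤ s.re) :
    ‖laplaceM F s‖ ≤ ∫ t in Set.Ioi (0:ℝ), opNormR (F t) := by
  rw [laplaceM_eq_integral hFcont hFint hs]
  refine norm_integral_le_of_norm_le hFint
    ((ae_restrict_iff' measurableSet_Ioi).mpr (.of_forall fun t ht => ?_))
  exact norm_exp_smul_map_ofReal_le (F t) hs (le_of_lt ht)

theorem norm_laplaceM_zero_sub_le {N : ℕ} {F : ℝ → Matrix (Fin N) (Fin N) ℝ}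
    (hFcont : ContinuousOn F (Set.Ici 0))
    (hFint : IntegrableOn (fun t => opNormR (F t)) (Set.Ioi 0))
    (hFtint : IntegrableOn (fun t => t * opNormR (F t)) (Set.Ioi 0)) {s : ℂ} (hs : 0 ≤ s.re) :
    ‖laplaceM F 0 - laplaceM F s‖ ≤ ‖s‖ * ∫ t in Set.Ioi (0:ℝ), t * opNormR (F t) := by
  have h0 : 0 ≤ (0 : ℂ).re := le_rfl
  rw [laplaceM_eq_integral hFcont hFint hs, laplaceM_eq_integral hFcont hFint h0,
    ← integral_sub (integrable_smul_map_ofReal hFcont hFint h0)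
      (integrable_smul_map_ofReal hFcont hFint hs), ← integral_const_mul]
  refine norm_integral_le_of_norm_le (hFtint.const_mul _)
    ((ae_restrict_iff' measurableSet_Ioi).mpr (.of_forall fun t ht => ?_))
  have ht : 0 < t := ht
  have h1 : ‖1 - Complex.exp (-(s * t))‖ ≤ ‖s‖ * t := by
    refine (norm_one_sub_exp_neg_le ?_).trans_eq ?_
    · simpa using mul_nonneg hs ht.le
    · rw [norm_mul, Complex.norm_real, Real.norm_of_nonneg ht.le]
  rw [← sub_smul, norm_smul, neg_zero, zero_mul, Complex.exp_zero, neg_mul, ← mul_assoc]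
  exact mul_le_mul h1 (norm_map_ofReal_le_opNormR _) (norm_nonneg _) (by positivity)

theorem stmt_6 {N : ℕ} (hN : 1 ≤ N) (E : Matrix (Fin N) (Fin N) ℝ)
    (F : ℝ → Matrix (Fin N) (Fin N) ℝ)
    (hFcont : ContinuousOn F (Set.Ici 0))
    (hFint : IntegrableOn (fun t => opNormR (F t)) (Set.Ioi 0))
    (hFtint : IntegrableOn (fun t => t * opNormR (F t)) (Set.Ioi 0))
    (Fplus : ℝ) (hFplus : Fplus = ∫ t in Set.Ioi (0:ℝ), opNormR (F t))
    (hFplusPos : 0 < Fplus)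
    (Fhat0 : Matrix (Fin N) (Fin N) ℝ)
    (hFhat0 : Fhat0 = Matrix.of fun i j => ∫ t in Set.Ioi (0:ℝ), F t i j)
    (hHurwitz : IsHurwitz (E + Fhat0))
    (lam1 : ℂ)
    (hlam1 : lam1 ∈ spectrum ℂ ((E + Fhat0).map Complex.ofReal))
    (hlam1max : ∀ μ ∈ spectrum ℂ ((E + Fhat0).map Complex.ofReal), μ.re ≤ lam1.re)
    (hcond : (∫ t in Set.Ioi (0:ℝ), t * (opNormR (F t) / Fplus)) <
      2 * |lam1.re| ^ N / (N * (2 * opNormR E + 2 * Fplus) ^ N * Fplus)) :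
    ∀ s : ℂ, 0 ≤ s.re →
      (s • (1 : Matrix (Fin N) (Fin N) ℂ) - E.map Complex.ofReal - laplaceM F s).det ≠ 0 := by
  intro s hs hdet0
  obtain ⟨w, hw0, hw⟩ := Matrix.exists_mulVec_eq_zero_iff.mpr hdet0
  set v : EuclideanSpace ℂ (Fin N) := WithLp.toLp 2 w with hv
  have hvpos : 0 < ‖v‖ := norm_pos_iff.mpr fun h => hw0 (by
    simpa [hv] using congrArg (WithLp.ofLp) h)
  set E' := E.map Complex.ofReal with hE'
  set A := (E + Fhat0).map Complex.ofReal with hA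
  have hAeq : A = E' + laplaceM F 0 := by
    ext i j
    simp [hA, hE', hFhat0, laplaceM, integral_complex_ofReal]
  set R := opNormR E + Fplus with hR
  have hE0 : 0 ≤ opNormR E := norm_nonneg _
  have hRpos : 0 < R := by positivity
  have hEle : ‖E'‖ ≤ opNormR E := norm_map_ofReal_le_opNormR E
  have hFle : ∀ z : ℂ, 0 ≤ z.re → ‖laplaceM F z‖ ≤ Fplus := fun z hz =>
    hFplus ▸ norm_laplaceM_le hFcont hFint hz
  have hBv : s • v = Matrix.toEuclideanCLM (𝕜 := ℂ) (E' + laplaceM F s) v := by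
    apply WithLp.ofLp_injective 2
    rw [sub_sub, Matrix.sub_mulVec, Matrix.smul_mulVec, Matrix.one_mulVec, sub_eq_zero] at hw
    simpa [hv, Matrix.add_mulVec] using hw
  have hsR : ‖s‖ ≤ R := by
    refine le_of_mul_le_mul_right ?_ hvpos
    rw [← norm_smul, hBv]
    refine ((Matrix.toEuclideanCLM (𝕜 := ℂ) (E' + laplaceM F s)).le_opNorm v).trans
      (mul_le_mul_of_nonneg_right ?_ hvpos.le)
    rw [Matrix.l2_opNorm_toEuclideanCLM]
    exact (norm_add_le _ _).trans (add_le_add hEle (hFle s hs))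
  set M := s • (1 : Matrix (Fin N) (Fin N) ℂ) - A with hM
  set J := ∫ t in Set.Ioi (0:ℝ), t * opNormR (F t) with hJ
  have hJ0 : 0 ≤ J := setIntegral_nonneg measurableSet_Ioi fun t ht =>
    mul_nonneg (le_of_lt ht) (norm_nonneg _)
  have hMnorm : ‖M‖ ≤ 2 * R := by
    have h1 : ‖s • (1 : Matrix (Fin N) (Fin N) ℂ)‖ ≤ ‖s‖ := by
      rw [Matrix.cstar_norm_def, map_smul, map_one, norm_smul]
      exact mul_le_of_le_one_right (norm_nonneg _) ContinuousLinearMap.norm_id_le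
    have h2 : ‖A‖ ≤ R := by
      rw [hAeq]
      exact (norm_add_le _ _).trans (add_le_add hEle (hFle 0 le_rfl))
    linarith [norm_sub_le (s • (1 : Matrix (Fin N) (Fin N) ℂ)) A]
  have hMv : ‖Matrix.toEuclideanCLM (𝕜 := ℂ) M v‖ ≤ R * J * ‖v‖ := by
    have h1 : Matrix.toEuclideanCLM (𝕜 := ℂ) M v
        = -Matrix.toEuclideanCLM (𝕜 := ℂ) (laplaceM F 0 - laplaceM F s) v := by
      rw [hM, hAeq, map_sub, map_smul, map_one, sub_apply,
        smul_apply, one_apply_eq_self, hBv]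
      simp only [map_add, map_sub, add_apply, sub_apply]
      abel
    rw [h1, norm_neg]
    refine (ContinuousLinearMap.le_opNorm _ v).trans (mul_le_mul_of_nonneg_right ?_ hvpos.le)
    rw [Matrix.l2_opNorm_toEuclideanCLM]
    exact (norm_laplaceM_zero_sub_le hFcont hFint hFtint hs).trans
      (mul_le_mul_of_nonneg_right hsR hJ0)
  have hupper : ‖M.det‖ ≤ (2 * R) ^ (N - 1) * (R * J) := by
    refine le_of_mul_le_mul_right ?_ hvpos
    refine (norm_det_mul_norm_le_s6 M v).trans ?_
    rw [mul_assoc]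
    exact mul_le_mul (pow_le_pow_left₀ (norm_nonneg _) hMnorm _) hMv (norm_nonneg _)
      (by positivity)
  have hlower : |lam1.re| ^ N ≤ ‖M.det‖ := by
    refine pow_le_norm_det_smul_one_sub A s _ (abs_nonneg _) fun μ hμ => ?_
    refine le_trans ?_ (Complex.re_le_norm _)
    rw [abs_of_neg (hHurwitz lam1 hlam1), Complex.sub_re]
    linarith [hlam1max μ hμ]
  have hτ : (∫ t in Set.Ioi (0:ℝ), t * (opNormR (F t) / Fplus)) = J / Fplus := by
    rw [hJ, ← integral_div]
    simp_rw [mul_div_assoc]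
  have hN1 : (1 : ℝ) ≤ N := by exact_mod_cast hN
  have hpow : (2 * R) ^ N = (2 * R) ^ (N - 1) * (2 * R) := by
    rw [← pow_succ, Nat.sub_add_cancel hN]
  rw [hτ, show 2 * opNormR E + 2 * Fplus = 2 * R by ring, lt_div_iff₀ (by positivity),
    show J / Fplus * (N * (2 * R) ^ N * Fplus) = N * ((2 * R) ^ N * J) by field_simp, hpow] at hcond
  have hK : 0 ≤ (2 * R) ^ (N - 1) * (2 * R) * J := by positivity
  nlinarith [le_mul_of_one_le_left hK hN1]
end

section
/- Let n ≥ 1, M ≥ 1, let Ω₁, Ω₂ be real symmetric 2n×2n matrices, Ω₁₂ a real 2n×2n matrix, V₁, V₂, V₁₂, V₂₁ complex M×2n matrices, and Γ₁, Γ₂ : [0,∞) → ℝ^{M×M} continuous. Define R = [[Ω₁, Ω₁₂],[Ω₁₂ᵀ, Ω₂]], V = [[V₁, V₁₂],[V₂₁, V₂]], Γ(t) = [[Γ₁(t), 0],[0, Γ₂(t)]], A_H = 2·J_{2n}·R and A_K(t) = 2·J_{2n}·Im(V†·Γ(t)·V). Assume Ω₁ + Ω₁₂ = Ω₁₂ᵀ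 + Ω₂ and, for all t ≥ 0, Im(V₁†Γ₁(t)V₁ + V₂₁†Γ₂(t)V₂₁) + Im(V₁†Γ₁(t)V₁₂ + V₂₁†Γ₂(t)V₂) = Im(V₁₂†Γ₁(t)V₁ + V₂†Γ₂(t)V₂₁) + Im(V₁₂†Γ₁(t)V₁₂ + V₂†Γ₂(t)V₂). Let x : [0,∞) → ℝ^{4n} be continuously differentiable with x'(t) = A_H·x(t) + ∫₀^t A_K(t−τ)·x(τ) dτ for all t ≥ 0, and write x = (x₁, x₂) with x₁, x₂ the first and last 2n components. Then e = x₁ − x₂ satisfies e'(t) = E·e(t) + ∫₀^t F(t−τ)·e(τ) dτ for all t ≥ 0, where E = 2·J_n·(Ω₁ − Ω₁₂ᵀ) and F(t) = 2·J_n·Im(V₁†Γ₁(t)V₁ + V₂₁†Γ₂(t)V₂₁) − 2·J_n·Im(V₁₂†Γ₁(t)V₁ + V₂†Γ₂(t)V₂₁). -/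
open Matrix MeasureTheory Set

/-- `J_k = I_k ⊗ J` where `J = [[0,1],[-1,0]]`: the `2k × 2k` block-diagonal matrix
with `2×2` blocks `J` (interleaved coordinate ordering). -/
def Jmat (k : ℕ) : Matrix (Fin (2*k)) (Fin (2*k)) ℝ :=
  Matrix.of fun i j =>
    if (i : ℕ) % 2 = 0 ∧ (j : ℕ) = (i : ℕ) + 1 then 1
    else if (i : ℕ) % 2 = 1 ∧ (j : ℕ) + 1 = (i : ℕ) then -1 else 0

/-- `J_{2n}` on the doubled (augmented) space, identified with
`fromBlocks (Jmat n) 0 0 (Jmat n)`. -/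
def J2n (n : ℕ) : Matrix (Fin (2*n) ⊕ Fin (2*n)) (Fin (2*n) ⊕ Fin (2*n)) ℝ :=
  Matrix.fromBlocks (Jmat n) 0 0 (Jmat n)

/-- Entrywise imaginary part of a complex matrix. -/
def matIm {m l : Type*} (A : Matrix m l ℂ) : Matrix m l ℝ := A.map Complex.im

/-- The continuous linear map sending `(u, v)` to `u - v`. -/
noncomputable def blockDiff (ι : Type*) [Fintype ι] : (ι ⊕ ι → ℝ) →L[ℝ] (ι → ℝ) :=
  LinearMap.toContinuousLinearMap
    (LinearMap.funLeft ℝ ℝ (Sum.inl : ι → ι ⊕ ι) - LinearMap.funLeft ℝ ℝ (Sum.inr : ι → ι ⊕ ι))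

theorem blockDiff_apply {ι : Type*} [Fintype ι] (v : ι ⊕ ι → ℝ) :
    blockDiff ι v = v ∘ Sum.inl - v ∘ Sum.inr := rfl

/-- A block matrix with equal row-block sums intertwines with the difference of the blocks. -/
theorem blockDiff_fromBlocks_mulVec {ι : Type*} [Fintype ι] {a b c d : Matrix ι ι ℝ}
    (h : a + b = c + d) (v : ι ⊕ ι → ℝ) :
    blockDiff ι (fromBlocks a b c d *ᵥ v) = (a - c) *ᵥ blockDiff ι v := by
  have hd : d = a + b - c := by rw [h]; abel
  subst hd
  simp only [blockDiff_apply, fromBlocks_mulVec, Sum.elim_comp_inl, Sum.elim_comp_inr,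
    mulVec_sub, sub_mulVec, add_mulVec]
  abel

theorem blockDiff_J2n_mulVec {n : ℕ} {a b c d : Matrix (Fin (2*n)) (Fin (2*n)) ℝ}
    (h : a + b = c + d) (v : Fin (2*n) ⊕ Fin (2*n) → ℝ) :
    blockDiff _ (((2 : ℝ) • (J2n n * fromBlocks a b c d)) *ᵥ v)
      = ((2 : ℝ) • (Jmat n * (a - c))) *ᵥ blockDiff _ v := by
  simp only [J2n, fromBlocks_multiply, zero_mul, add_zero, zero_add, smul_mulVec, map_smul]
  rw [blockDiff_fromBlocks_mulVec (by rw [← mul_add, h, mul_add]), mul_sub]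

theorem matIm_fromBlocks {m l o p : Type*} (a : Matrix m l ℂ) (b : Matrix m o ℂ)
    (c : Matrix p l ℂ) (d : Matrix p o ℂ) :
    matIm (fromBlocks a b c d) = fromBlocks (matIm a) (matIm b) (matIm c) (matIm d) :=
  fromBlocks_map _ _ _ _ _

theorem continuous_matIm {m l : Type*} : Continuous (matIm : Matrix m l ℂ → Matrix m l ℝ) :=
  continuous_id.matrix_map Complex.continuous_im

theorem stmt_14 {n M : ℕ} (hn : 1 ≤ n) (hM : 1 ≤ M)
    (Ω₁ Ω₂ Ω₁₂ : Matrix (Fin (2*n)) (Fin (2*n)) ℝ)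
    (hΩ₁sym : Ω₁ᵀ = Ω₁) (hΩ₂sym : Ω₂ᵀ = Ω₂)
    (V₁ V₂ V₁₂ V₂₁ : Matrix (Fin M) (Fin (2*n)) ℂ)
    (Γ₁ Γ₂ : ℝ → Matrix (Fin M) (Fin M) ℝ)
    (hΓ₁cont : ContinuousOn Γ₁ (Set.Ici 0)) (hΓ₂cont : ContinuousOn Γ₂ (Set.Ici 0))
    (R : Matrix (Fin (2*n) ⊕ Fin (2*n)) (Fin (2*n) ⊕ Fin (2*n)) ℝ)
    (hR : R = Matrix.fromBlocks Ω₁ Ω₁₂ Ω₁₂ᵀ Ω₂)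
    (V : Matrix (Fin M ⊕ Fin M) (Fin (2*n) ⊕ Fin (2*n)) ℂ)
    (hV : V = Matrix.fromBlocks V₁ V₁₂ V₂₁ V₂)
    (Γ : ℝ → Matrix (Fin M ⊕ Fin M) (Fin M ⊕ Fin M) ℂ)
    (hΓ : ∀ t, Γ t = Matrix.fromBlocks ((Γ₁ t).map Complex.ofReal) 0 0
      ((Γ₂ t).map Complex.ofReal))
    (AH : Matrix (Fin (2*n) ⊕ Fin (2*n)) (Fin (2*n) ⊕ Fin (2*n)) ℝ)
    (hAH : AH = (2 : ℝ) • (J2n n * R))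
    (AK : ℝ → Matrix (Fin (2*n) ⊕ Fin (2*n)) (Fin (2*n) ⊕ Fin (2*n)) ℝ)
    (hAK : ∀ t, AK t = (2 : ℝ) • (J2n n * matIm (Vᴴ * Γ t * V)))
    (hΩ : Ω₁ + Ω₁₂ = Ω₁₂ᵀ + Ω₂)
    (hIm : ∀ t ≥ (0:ℝ),
      matIm (V₁ᴴ * (Γ₁ t).map Complex.ofReal * V₁ + V₂₁ᴴ * (Γ₂ t).map Complex.ofReal * V₂₁)
      + matIm (V₁ᴴ * (Γ₁ t).map Complex.ofReal * V₁₂ + V₂₁ᴴ * (Γ₂ t).map Complex.ofReal * V₂)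
      = matIm (V₁₂ᴴ * (Γ₁ t).map Complex.ofReal * V₁ + V₂ᴴ * (Γ₂ t).map Complex.ofReal * V₂₁)
      + matIm (V₁₂ᴴ * (Γ₁ t).map Complex.ofReal * V₁₂ + V₂ᴴ * (Γ₂ t).map Complex.ofReal * V₂))
    (x : ℝ → (Fin (2*n) ⊕ Fin (2*n)) → ℝ)
    (hx : ∀ t ≥ (0:ℝ), HasDerivWithinAt x
      (AH.mulVec (x t) + ∫ τ in Set.Icc (0:ℝ) t, (AK (t - τ)).mulVec (x τ)) (Set.Ici 0) t)
    (e : ℝ → Fin (2*n) → ℝ)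
    (he : ∀ t i, e t i = x t (Sum.inl i) - x t (Sum.inr i))
    (E : Matrix (Fin (2*n)) (Fin (2*n)) ℝ)
    (hE : E = (2 : ℝ) • (Jmat n * (Ω₁ - Ω₁₂ᵀ)))
    (F : ℝ → Matrix (Fin (2*n)) (Fin (2*n)) ℝ)
    (hF : ∀ t, F t =
      (2 : ℝ) • (Jmat n * matIm (V₁ᴴ * (Γ₁ t).map Complex.ofReal * V₁
        + V₂₁ᴴ * (Γ₂ t).map Complex.ofReal * V₂₁))
      - (2 : ℝ) • (Jmat n * matIm (V₁₂ᴴ * (Γ₁ t).map Complex.ofReal * V₁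
        + V₂ᴴ * (Γ₂ t).map Complex.ofReal * V₂₁))) :
    ∀ t ≥ (0:ℝ), HasDerivWithinAt e
      (E.mulVec (e t) + ∫ τ in Set.Icc (0:ℝ) t, (F (t - τ)).mulVec (e τ)) (Set.Ici 0) t := by
  have hes : e = fun t => blockDiff _ (x t) := by
    funext t i
    exact he t i
  have hAHe (v) : blockDiff _ (AH *ᵥ v) = E *ᵥ blockDiff _ v := by
    rw [hAH, hR, hE, blockDiff_J2n_mulVec hΩ]
  have hAKe (s : ℝ) (hs : 0 ≤ s) (v) : blockDiff _ (AK s *ᵥ v) = F s *ᵥ blockDiff _ v := by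
    have hblocks : Vᴴ * Γ s * V = fromBlocks
        (V₁ᴴ * (Γ₁ s).map Complex.ofReal * V₁ + V₂₁ᴴ * (Γ₂ s).map Complex.ofReal * V₂₁)
        (V₁ᴴ * (Γ₁ s).map Complex.ofReal * V₁₂ + V₂₁ᴴ * (Γ₂ s).map Complex.ofReal * V₂)
        (V₁₂ᴴ * (Γ₁ s).map Complex.ofReal * V₁ + V₂ᴴ * (Γ₂ s).map Complex.ofReal * V₂₁)
        (V₁₂ᴴ * (Γ₁ s).map Complex.ofReal * V₁₂ + V₂ᴴ * (Γ₂ s).map Complex.ofReal * V₂) := by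
      simp [hV, hΓ, fromBlocks_conjTranspose, fromBlocks_multiply]
    rw [hAK, hblocks, matIm_fromBlocks, blockDiff_J2n_mulVec (hIm s hs), hF, mul_sub, smul_sub]
  have hΓcont : ContinuousOn Γ (Ici 0) := by
    have hblock : Continuous fun p : Matrix (Fin M) (Fin M) ℝ × Matrix (Fin M) (Fin M) ℝ =>
        fromBlocks (p.1.map Complex.ofReal) 0 0 (p.2.map Complex.ofReal) :=
      (continuous_fst.matrix_map Complex.continuous_ofReal).matrix_fromBlocks continuous_const
        continuous_const (continuous_snd.matrix_map Complex.continuous_ofReal)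
    rw [show Γ = _ from funext hΓ]
    exact hblock.comp_continuousOn (hΓ₁cont.prodMk hΓ₂cont)
  have hAKcont : ContinuousOn AK (Ici 0) := by
    have hlin : Continuous fun G : Matrix (Fin M ⊕ Fin M) (Fin M ⊕ Fin M) ℂ =>
        (2 : ℝ) • (J2n n * matIm (Vᴴ * G * V)) := by
      refine Continuous.const_smul (continuous_const.matrix_mul (continuous_matIm.comp ?_)) (2 : ℝ)
      exact (continuous_const.matrix_mul continuous_id).matrix_mul continuous_const
    rw [show AK = _ from funext hAK]
    exact hlin.comp_continuousOn hΓcont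
  have hxcont : ContinuousOn x (Ici 0) := fun t ht => (hx t ht).continuousWithinAt
  intro t ht
  have hint : IntegrableOn (fun τ => AK (t - τ) *ᵥ x τ) (Icc 0 t) := by
    have hmul : Continuous fun p : Matrix (Fin (2*n) ⊕ Fin (2*n)) (Fin (2*n) ⊕ Fin (2*n)) ℝ ×
        (Fin (2*n) ⊕ Fin (2*n) → ℝ) => p.1 *ᵥ p.2 :=
      continuous_fst.matrix_mulVec continuous_snd
    refine ContinuousOn.integrableOn_Icc (hmul.comp_continuousOn (ContinuousOn.prodMk ?_ ?_))
    · exact hAKcont.comp (by fun_prop) fun τ hτ => sub_nonneg.2 hτ.2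
    · exact hxcont.mono fun τ hτ => hτ.1
  have hderiv := (blockDiff (Fin (2*n))).hasFDerivAt.comp_hasDerivWithinAt t (hx t ht)
  rw [map_add, hAHe, ← ContinuousLinearMap.integral_comp_comm _ hint,
    setIntegral_congr_fun measurableSet_Icc
      (fun τ hτ => hAKe (t - τ) (sub_nonneg.2 hτ.2) (x τ))] at hderiv
  rw [hes]
  exact hderiv
end
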